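/- arXiv:1411.5673 — 2 statements merged into one kernel-verified Lean document; each statement's English description precedes it below -/
import Mathlib

section
/- For every χ ∈ (0,1) there exists δ₀ > 0, depending only on χ and h, such that for every δ with |δ| < δ₀ the map Ψ_δ is (1+χ)-bi-Lipschitz: (1+χ)^{-1}·|x − y| ≤ |Ψ_δ(x) − Ψ_δ(y)| ≤ (1+χ)·|x − y| for all x, y ∈ [0,1]². -/
open MeasureTheory Set Filter

noncomputable section

/-- The closed unit square `[0,1]²` in the plane `ℝ × ℝ`. -/
def unitSq : Set (ℝ × ℝ) := Set.Icc (0:ℝ) 1 ×ˢ Set.Icc (0:ℝ) 1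

/-- The topological boundary of the unit square. -/
def unitSqBdry : Set (ℝ × ℝ) :=
  {x ∈ unitSq | x.1 = 0 ∨ x.1 = 1 ∨ x.2 = 0 ∨ x.2 = 1}

/-- The domain `[0,1] × [0,1/2) \ {(1/2,0)}` of the parametrisation `K`. -/
def lowerDom : Set (ℝ × ℝ) :=
  (Set.Icc (0:ℝ) 1 ×ˢ Set.Ico (0:ℝ) (1/2)) \ {((1/2 : ℝ), (0 : ℝ))}

/-- The hypotheses on the auxiliary function `h : [0,1/2) → [0,∞)`. -/
def GoodH (h : ℝ → ℝ) : Prop :=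
  (∀ r ∈ Set.Ico (0:ℝ) (1/2), 0 ≤ h r) ∧
  MonotoneOn h (Set.Ico (0:ℝ) (1/2)) ∧
  (∀ r ∈ Set.Icc (0:ℝ) (1/10), h r = 0) ∧
  Filter.Tendsto h (nhdsWithin (1/2 : ℝ) (Set.Iio (1/2 : ℝ))) Filter.atTop ∧
  ContDiffOn ℝ 3 h (Set.Ico (0:ℝ) (1/2)) ∧
  ∃ c : ℝ, ∀ r ∈ Set.Ico (0:ℝ) (1/2),
    (deriv h r) ^ 2 ≤ c * (r + h r) ^ 3 ∧
    deriv (deriv h) r * deriv h r ≤ c * (r + h r) ^ 3 ∧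
    |deriv (deriv (deriv h)) r| ≤ c * (r + h r) ^ 2

/-- The defining property of the angle function `Θ`. -/
def GoodTheta (h : ℝ → ℝ) (r₀ : ℝ) (Θ : ℝ → ℝ) : Prop :=
  (∀ r : ℝ, 0 < r → r ≤ r₀ → Θ r = Real.arccos (h r / (h r + r))) ∧
  (∀ r : ℝ, r₀ < r → r < 1/2 → Θ r = Real.arcsin (1 / (2 * (h r + r))))

/-- The defining property of the `r-θ` parametrisation `K`. -/
def GoodK (h Θ : ℝ → ℝ) (K : ℝ × ℝ → ℝ × ℝ) : Prop :=
  Set.BijOn K lowerDom (Set.Ioo (0:ℝ) (1/2) ×ˢ Set.Icc (-1:ℝ) 1) ∧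
  ∀ x ∈ lowerDom,
    x.1 = 1/2 + ((K x).1 + h (K x).1) * Real.sin ((K x).2 * Θ (K x).1) ∧
    x.2 = ((K x).1 + h (K x).1) * Real.cos ((K x).2 * Θ (K x).1) - h (K x).1

/-- The weight function `w_r(θ) = 1 + h'(r) − h'(r) cos(θ Θ(r))`. -/
def wgt (h Θ : ℝ → ℝ) (r θ : ℝ) : ℝ :=
  1 + deriv h r - deriv h r * Real.cos (θ * Θ r)

/-- The defining properties of the family of stretching bijections `g_r`. -/
def IsGFamily (h Θ : ℝ → ℝ) (δ : ℝ) (g : ℝ → ℝ → ℝ) : Prop :=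
  ∀ r ∈ Set.Ioo (0:ℝ) (1/2),
    StrictMonoOn (g r) (Set.Icc (-1:ℝ) 1) ∧
    Set.BijOn (g r) (Set.Icc (-1:ℝ) 1) (Set.Icc (-1:ℝ) 1) ∧
    g r (-1) = -1 ∧ g r 1 = 1 ∧
    (∀ ℓ ∈ Set.Icc (-1:ℝ) 0,
      (1 + δ) * ∫ θ in (-1:ℝ)..ℓ, wgt h Θ r θ = ∫ θ in (-1:ℝ)..(g r ℓ), wgt h Θ r θ) ∧
    (∀ ℓ ∈ Set.Icc (0:ℝ) 1,
      (1 - δ) * ∫ θ in ℓ..(1:ℝ), wgt h Θ r θ = ∫ θ in (g r ℓ)..(1:ℝ), wgt h Θ r θ)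

/-- The defining properties of the map `Ψ_δ` in terms of `K` and the family `g`. -/
def IsPsi (K : ℝ × ℝ → ℝ × ℝ) (δ : ℝ) (g : ℝ → ℝ → ℝ) (Ψ : ℝ × ℝ → ℝ × ℝ) : Prop :=
  (∀ x ∈ lowerDom, Ψ x ∈ lowerDom ∧ (K (Ψ x)).1 = (K x).1 ∧
      (K (Ψ x)).2 = g (K x).1 (K x).2) ∧
  Ψ (1/2, 0) = (1/2, 0) ∧
  (∀ x ∈ unitSq, 1/2 < x.2 → Ψ x = ((Ψ (x.1, 1 - x.2)).1, 1 - (Ψ (x.1, 1 - x.2)).2)) ∧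
  (∀ x₁ : ℝ, 0 ≤ x₁ → x₁ ≤ 1/2 → Ψ (x₁, 1/2) = ((1 + δ) * x₁, 1/2)) ∧
  (∀ x₁ : ℝ, 1/2 ≤ x₁ → x₁ ≤ 1 → Ψ (x₁, 1/2) = ((1 + δ)/2 + (1 - δ) * (x₁ - 1/2), 1/2))

/-- Euclidean distance on `ℝ × ℝ`. -/
def eucDist (x y : ℝ × ℝ) : ℝ := Real.sqrt ((x.1 - y.1) ^ 2 + (x.2 - y.2) ^ 2)

theorem px_slope {G G' : ℝ → ℝ} (hG : ∀ t ∈ Set.Icc (0:ℝ) 1, HasDerivAt G (G' t) t) :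
    ∃ t ∈ Set.Icc (0:ℝ) 1, G 1 - G 0 = G' t := by
  obtain ⟨t, ht, he⟩ := exists_hasDerivAt_eq_slope G G' (zero_lt_one)
    (fun t ht => (hG t ht).continuousAt.continuousWithinAt)
    (fun t ht => hG t ⟨ht.1.le, ht.2.le⟩)
  exact ⟨t, ⟨ht.1.le, ht.2.le⟩, by rw [he]; simp⟩

theorem px_conv {b s t τ : ℝ} (hs : |s| ≤ b) (ht : |t| ≤ b) (hτ : τ ∈ Set.Icc (0:ℝ) 1) :
    |s + τ * (t - s)| ≤ b := by
  have hs := abs_le.1 hs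
  have ht := abs_le.1 ht
  obtain ⟨h0, h1⟩ := hτ
  rw [abs_le]
  constructor <;> nlinarith

theorem px_diff {F1 F2 q1 q2 : ℝ → ℝ} {b : ℝ}
    (h1 : ∀ s, |s| ≤ b → HasDerivAt F1 (q1 s) s)
    (h2 : ∀ s, |s| ≤ b → HasDerivAt F2 (q2 s) s) {s1 t1 s2 t2 : ℝ}
    (hs1 : |s1| ≤ b) (ht1 : |t1| ≤ b) (hs2 : |s2| ≤ b) (ht2 : |t2| ≤ b) :
    ∃ u1 u2 : ℝ, |u1| ≤ b ∧ |u2| ≤ b ∧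
      |u2 - u1| ≤ |s2 - s1| + |(t2 - s2) - (t1 - s1)| ∧
      (F2 t2 - F2 s2) - (F1 t1 - F1 s1) = (t2 - s2) * q2 u2 - (t1 - s1) * q1 u1 := by
  have key : ∀ {F q : ℝ → ℝ} {s t : ℝ}, (∀ s, |s| ≤ b → HasDerivAt F (q s) s) →
      |s| ≤ b → |t| ≤ b → ∀ τ ∈ Set.Icc (0:ℝ) 1,
      HasDerivAt (fun τ => F (s + τ * (t - s))) ((t - s) * q (s + τ * (t - s))) τ := by
    intro F q s t hF hs ht τ hτ
    have hi : HasDerivAt (fun τ : ℝ => s + τ * (t - s)) (t - s) τ := by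
      simpa using ((hasDerivAt_id τ).mul_const (t - s)).const_add s
    have := (hF _ (px_conv hs ht hτ)).comp τ hi
    rw [mul_comm]
    exact this
  obtain ⟨τ, hτ, he⟩ := px_slope (fun τ hτ =>
    (key h2 hs2 ht2 τ hτ).sub (key h1 hs1 ht1 τ hτ))
  refine ⟨s1 + τ * (t1 - s1), s2 + τ * (t2 - s2), px_conv hs1 ht1 hτ, px_conv hs2 ht2 hτ, ?_, ?_⟩
  · have : s2 + τ * (t2 - s2) - (s1 + τ * (t1 - s1)) =
      (s2 - s1) + τ * ((t2 - s2) - (t1 - s1)) := by ring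
    rw [this]
    refine (abs_add_le _ _).trans ?_
    rw [abs_mul, abs_of_nonneg hτ.1]
    have := mul_le_of_le_one_left (abs_nonneg ((t2 - s2) - (t1 - s1))) hτ.2
    linarith
  · simp at he
    linarith

theorem px_one {F q : ℝ → ℝ} {b : ℝ}
    (h1 : ∀ s, |s| ≤ b → HasDerivAt F (q s) s) {s t : ℝ}
    (hs : |s| ≤ b) (ht : |t| ≤ b) : ∃ u, |u| ≤ b ∧ F t - F s = (t - s) * q u := by
  have hb : 0 ≤ b := (abs_nonneg _).trans hs
  obtain ⟨u1, u2, -, hu2, -, he⟩ := px_diff (F1 := fun _ => 0) (q1 := fun _ => 0) (F2 := F) (b := b)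
    (fun s _ => hasDerivAt_const s 0) h1 hs hs hs ht
  exact ⟨u2, hu2, by simpa using he⟩

theorem px_core {I : Set ℝ} {F q : ℝ → ℝ → ℝ} {T : ℝ → ℝ} {b M : ℝ} (hb : 0 ≤ b) (hM : 1 ≤ M)
    (hF : ∀ r ∈ I, ∀ s, |s| ≤ b → HasDerivAt (F r) (q r s) s)
    (hq1 : ∀ r ∈ I, ∀ s, |s| ≤ b → 1 ≤ q r s)
    (hqM : ∀ r ∈ I, ∀ s, |s| ≤ b → q r s ≤ M)
    (hqL : ∀ r ∈ I, ∀ r' ∈ I, ∀ s s', |s| ≤ b → |s'| ≤ b →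
      |q r' s' - q r s| ≤ M * (|r' - r| + |s' - s|))
    (hF0 : ∀ r ∈ I, F r 0 = 0)
    (hT : ∀ r ∈ I, |T r| ≤ b)
    (hTL : ∀ r ∈ I, ∀ r' ∈ I, |T r' - T r| ≤ M * |r' - r|)
    {δ : ℝ} (hδ : |δ| * (2 * M * b) * M ≤ 1/2)
    {r r' s t s' t' : ℝ} (hr : r ∈ I) (hr' : r' ∈ I)
    (hs : |s| ≤ b) (ht : |t| ≤ b) (hs' : |s'| ≤ b) (ht' : |t'| ≤ b)
    (he : F r t = F r s + δ * (F r (T r) - |F r s|))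
    (he' : F r' t' = F r' s' + δ * (F r' (T r') - |F r' s'|)) :
    |t - s| ≤ |δ| * (2 * M * b) ∧
    |(t' - s') - (t - s)| ≤
      |δ| * (2 * (2 * M * b + M * M + M + 2 * M * M * b)) * (|r' - r| + |s' - s|) := by
  have hM0 : 0 ≤ M := by linarith
  have hlin : ∀ r ∈ I, ∀ s t, |s| ≤ b → |t| ≤ b → |F r t - F r s| ≤ M * |t - s| := by
    intro r hr s t hs ht
    obtain ⟨u, hu, hu'⟩ := px_one (hF r hr) hs ht
    rw [hu', abs_mul, mul_comm]
    have h1 := hq1 r hr u hu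
    have h2 := hqM r hr u hu
    rw [abs_of_nonneg (by linarith)]
    exact mul_le_mul_of_nonneg_right h2 (abs_nonneg _)
  have h0 : |(0:ℝ)| ≤ b := by simpa using hb
  have hbd : ∀ r ∈ I, ∀ s, |s| ≤ b → |F r s| ≤ M * b := by
    intro r hr s hs
    have := hlin r hr 0 s h0 hs
    rw [hF0 r hr] at this
    simp only [sub_zero] at this
    exact this.trans (mul_le_mul_of_nonneg_left hs hM0)
  have hrL : ∀ r ∈ I, ∀ r' ∈ I, ∀ s, |s| ≤ b → |F r' s - F r s| ≤ M * b * |r' - r| := by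
    intro r hr r' hr' s hs
    obtain ⟨u1, u2, h1, h2, h3, h4⟩ := px_diff (hF r hr) (hF r' hr') h0 hs h0 hs
    rw [hF0 r hr, hF0 r' hr'] at h4
    simp only [sub_zero, sub_self, abs_zero, add_zero] at h3 h4
    have hu : u2 = u1 := by
      have := abs_nonneg (u2 - u1)
      have : |u2 - u1| = 0 := le_antisymm h3 this
      linarith [abs_eq_zero.1 this]
    subst hu
    rw [h4, ← mul_sub, abs_mul]
    have := hqL r hr r' hr' u2 u2 h1 h1
    simp only [sub_self, abs_zero, add_zero] at this
    calc |s| * |q r' u2 - q r u2| ≤ b * (M * |r' - r|) := by gcongr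
      _ = _ := by ring
  have hboth : ∀ r ∈ I, ∀ r' ∈ I, ∀ s s', |s| ≤ b → |s'| ≤ b →
      |F r' s' - F r s| ≤ M * b * |r' - r| + M * |s' - s| := by
    intro r hr r' hr' s s' hs hs'
    have h1 := hrL r hr r' hr' s' hs'
    have h2 := hlin r hr s s' hs hs'
    have := abs_sub_le (F r' s') (F r s') (F r s)
    linarith
  -- the displacement
  have hσ : |t - s| ≤ |δ| * (2 * M * b) := by
    obtain ⟨u, hu, hu'⟩ := px_one (hF r hr) hs ht
    have h1 := hq1 r hr u hu
    have e1 : F r t - F r s = δ * (F r (T r) - |F r s|) := by rw [he]; ring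
    have e2 : |F r t - F r s| ≤ |δ| * (2 * M * b) := by
      rw [e1, abs_mul]
      refine mul_le_mul_of_nonneg_left ?_ (abs_nonneg _)
      refine (abs_sub _ _).trans ?_
      rw [abs_abs]
      linarith [hbd r hr s hs, hbd r hr (T r) (hT r hr)]
    refine le_trans ?_ e2
    rw [hu', abs_mul]
    refine le_mul_of_one_le_right (abs_nonneg _) ?_
    exact h1.trans (le_abs_self _)
  refine ⟨hσ, ?_⟩
  obtain ⟨u1, u2, h1, h2, h3, h4⟩ := px_diff (hF r hr) (hF r' hr') hs ht hs' ht'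
  set e := |r' - r| + |s' - s| with hedef
  have hr0 := abs_nonneg (r' - r)
  have hs0 := abs_nonneg (s' - s)
  set Δ := (t' - s') - (t - s) with hΔ
  have hE : |(F r' t' - F r' s') - (F r t - F r s)| ≤ |δ| * (2 * M * b + M * M + M) * e := by
    have : (F r' t' - F r' s') - (F r t - F r s) =
        δ * ((F r' (T r') - F r (T r)) - (|F r' s'| - |F r s|)) := by
      rw [he, he']; ring
    rw [this, abs_mul, mul_assoc]
    refine mul_le_mul_of_nonneg_left ?_ (abs_nonneg _)
    refine (abs_sub _ _).trans ?_
    have a1 := hboth r hr r' hr' (T r) (T r') (hT r hr) (hT r' hr')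
    have a2 := hboth r hr r' hr' s s' hs hs'
    have a3 := abs_abs_sub_abs_le_abs_sub (F r' s') (F r s)
    have a4 := hTL r hr r' hr'
    have a5 : M * |T r' - T r| ≤ M * (M * |r' - r|) := mul_le_mul_of_nonneg_left a4 hM0
    have p1 : 0 ≤ M * b * |s' - s| := by positivity
    have p2 : 0 ≤ M * M * |s' - s| := by positivity
    have p3 : 0 ≤ M * |r' - r| := by positivity
    rw [hedef]
    nlinarith
  rw [h4] at hE
  have e5 : (t' - s') * q r' u2 - (t - s) * q r u1 =
      Δ * q r' u2 + (t - s) * (q r' u2 - q r u1) := by rw [hΔ]; ring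
  rw [e5] at hE
  have e6 : |Δ| ≤ |Δ * q r' u2| := by
    rw [abs_mul]
    exact le_mul_of_one_le_right (abs_nonneg _) ((hq1 r' hr' u2 h2).trans (le_abs_self _))
  have e7 : |(t - s) * (q r' u2 - q r u1)| ≤ |δ| * (2 * M * b) * (M * (e + |Δ|)) := by
    rw [abs_mul]
    have := hqL r hr r' hr' u1 u2 h1 h2
    refine mul_le_mul hσ (this.trans ?_) (abs_nonneg _) (by positivity)
    refine mul_le_mul_of_nonneg_left ?_ hM0
    linarith
  have e8 : |Δ * q r' u2| ≤ |Δ * q r' u2 + (t - s) * (q r' u2 - q r u1)| +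
      |(t - s) * (q r' u2 - q r u1)| := by
    have := abs_sub (Δ * q r' u2 + (t - s) * (q r' u2 - q r u1)) ((t - s) * (q r' u2 - q r u1))
    simpa using this
  have e9 : |δ| * (2 * M * b) * M * |Δ| ≤ 1/2 * |Δ| :=
    mul_le_mul_of_nonneg_right hδ (abs_nonneg _)
  nlinarith

/-- The constant in the displacement estimate. -/
def pxC (M b : ℝ) : ℝ := 2 * (2 * M * b + M * M + M + 2 * M * M * b)

theorem px_X {I : Set ℝ} {X p : ℝ → ℝ → ℝ} {b M B C : ℝ} (hM : 1 ≤ M) (hB : 0 ≤ B) (hC : 0 ≤ C)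
    (hF : ∀ r ∈ I, ∀ s, |s| ≤ b → HasDerivAt (X r) (p r s) s)
    (hqM : ∀ r ∈ I, ∀ s, |s| ≤ b → |p r s| ≤ M)
    (hqL : ∀ r ∈ I, ∀ r' ∈ I, ∀ s s', |s| ≤ b → |s'| ≤ b →
      |p r' s' - p r s| ≤ M * (|r' - r| + |s' - s|))
    {δ : ℝ} (hδ : |δ| ≤ 1)
    {r r' s t s' t' : ℝ} (hr : r ∈ I) (hr' : r' ∈ I)
    (hs : |s| ≤ b) (ht : |t| ≤ b) (hs' : |s'| ≤ b) (ht' : |t'| ≤ b)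
    (hσ : |t - s| ≤ |δ| * B)
    (hΔ : |(t' - s') - (t - s)| ≤ |δ| * C * (|r' - r| + |s' - s|)) :
    |(X r' t' - X r' s') - (X r t - X r s)| ≤
      |δ| * (M * C + B * M * (1 + C)) * (|r' - r| + |s' - s|) := by
  obtain ⟨u1, u2, h1, h2, h3, h4⟩ := px_diff (hF r hr) (hF r' hr') hs ht hs' ht'
  rw [h4]
  set e := |r' - r| + |s' - s| with hedef
  have he0 : 0 ≤ e := by positivity
  set Δ := (t' - s') - (t - s) with hΔd
  have e5 : (t' - s') * p r' u2 - (t - s) * p r u1 =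
      Δ * p r' u2 + (t - s) * (p r' u2 - p r u1) := by rw [hΔd]; ring
  rw [e5]
  refine (abs_add_le _ _).trans ?_
  rw [abs_mul, abs_mul]
  have a1 : |Δ| * |p r' u2| ≤ (|δ| * C * e) * M :=
    mul_le_mul hΔ (hqM r' hr' u2 h2) (abs_nonneg _) (by positivity)
  have a2 : |Δ| ≤ C * e := hΔ.trans (by
    rw [mul_assoc]
    exact mul_le_of_le_one_left (by positivity) hδ)
  have a3 : |t - s| * |p r' u2 - p r u1| ≤ (|δ| * B) * (M * (e + C * e)) := by
    refine mul_le_mul hσ ((hqL r hr r' hr' u1 u2 h1 h2).trans ?_) (abs_nonneg _) (by positivity)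
    refine mul_le_mul_of_nonneg_left ?_ (by linarith)
    linarith
  linarith

/-- Working facts about `h`. -/
structure PxH (h : ℝ → ℝ) (c : ℝ) : Prop where
  c0 : 0 ≤ c
  nn : ∀ r ∈ Set.Ioo (0:ℝ) (1/2), 0 ≤ h r
  mono : MonotoneOn h (Set.Ico (0:ℝ) (1/2))
  zero : ∀ r ∈ Set.Ioc (0:ℝ) (1/10), h r = 0
  lim : Filter.Tendsto h (nhdsWithin (1/2 : ℝ) (Set.Iio (1/2 : ℝ))) Filter.atTop
  d1 : ∀ r ∈ Set.Ioo (0:ℝ) (1/2), HasDerivAt h (deriv h r) r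
  d2 : ∀ r ∈ Set.Ioo (0:ℝ) (1/2), HasDerivAt (deriv h) (deriv (deriv h) r) r
  h1nn : ∀ r ∈ Set.Ioo (0:ℝ) (1/2), 0 ≤ deriv h r
  h1sq : ∀ r ∈ Set.Ioo (0:ℝ) (1/2), (deriv h r) ^ 2 ≤ c * (r + h r) ^ 3
  h2le : ∀ r ∈ Set.Ioo (0:ℝ) (1/2), |deriv (deriv h) r| ≤ c * (r + h r) ^ 2

theorem px_hfacts {h : ℝ → ℝ} (hh : GoodH h) : ∃ c, PxH h c := by
  obtain ⟨hnn, hmono, hzero, hlim, hcd, c, hc⟩ := hh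
  have sub : Set.Ioo (0:ℝ) (1/2) ⊆ Set.Ico (0:ℝ) (1/2) := Set.Ioo_subset_Ico_self
  have hcd' : ContDiffOn ℝ 3 h (Set.Ioo (0:ℝ) (1/2)) := hcd.mono sub
  have hopen : IsOpen (Set.Ioo (0:ℝ) (1/2)) := isOpen_Ioo
  have hcd1 : ContDiffOn ℝ 2 (deriv h) (Set.Ioo (0:ℝ) (1/2)) :=
    hcd'.deriv_of_isOpen hopen (by norm_num)
  have hcd2 : ContDiffOn ℝ 1 (deriv (deriv h)) (Set.Ioo (0:ℝ) (1/2)) :=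
    hcd1.deriv_of_isOpen hopen (by norm_num)
  have diff : ∀ {f : ℝ → ℝ} {n : WithTop ℕ∞}, n ≠ 0 → ContDiffOn ℝ n f (Set.Ioo (0:ℝ) (1/2)) →
      ∀ r ∈ Set.Ioo (0:ℝ) (1/2), HasDerivAt f (deriv f r) r := by
    intro f n hn hf r hr
    exact ((hf.differentiableOn hn).differentiableAt (hopen.mem_nhds hr)).hasDerivAt
  have d1 := diff (by norm_num) hcd'
  have d2 := diff (by norm_num) hcd1
  have d3 := diff (by norm_num) hcd2
  have c0 : 0 ≤ c := by
    have h20 : (1/20:ℝ) ∈ Set.Ico (0:ℝ) (1/2) := by norm_num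
    have := (hc (1/20) h20).1
    rw [hzero (1/20) (by norm_num)] at this
    have h2 := sq_nonneg (deriv h (1/20))
    norm_num at this
    by_contra hcon
    push Not at hcon
    nlinarith
  have hloc : ∀ r ∈ Set.Ioo (0:ℝ) (1/10), deriv h r = 0 := by
    intro r hr
    have : h =ᶠ[nhds r] fun _ => 0 := by
      filter_upwards [isOpen_Ioo.mem_nhds hr] with y hy
      exact hzero y ⟨hy.1.le, hy.2.le⟩
    rw [this.deriv_eq]; simp
  have hloc2 : ∀ r ∈ Set.Ioo (0:ℝ) (1/10), deriv (deriv h) r = 0 := by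
    intro r hr
    have : deriv h =ᶠ[nhds r] fun _ => 0 := by
      filter_upwards [isOpen_Ioo.mem_nhds hr] with y hy
      exact hloc y hy
    rw [this.deriv_eq]; simp
  refine ⟨c, c0, fun r hr => hnn r (sub hr), hmono, fun r hr => hzero r ⟨hr.1.le, hr.2⟩, hlim,
    d1, d2, ?_, fun r hr => (hc r (sub hr)).1, ?_⟩
  · intro r hr
    have h1 : derivWithin h (Set.Ioo (0:ℝ) (1/2)) r = deriv h r :=
      derivWithin_of_isOpen hopen hr
    rw [← h1]
    exact (hmono.mono sub).derivWithin_nonneg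
  · intro r hr
    have hRnn : 0 ≤ r + h r := by linarith [hr.1, hnn r (sub hr)]
    rcases lt_or_ge r (1/20) with hlt | hge
    · rw [hloc2 r ⟨hr.1, by linarith⟩]
      simp only [abs_zero]
      positivity
    · have key := (convex_Icc (1/20:ℝ) r).norm_image_sub_le_of_norm_hasDerivWithin_le
        (f := deriv (deriv h)) (f' := deriv (deriv (deriv h))) (C := c * (r + h r) ^ 2)
        (x := 1/20) (y := r)
        (fun x hx => (d3 x ⟨by linarith [hx.1], by linarith [hx.2, hr.2]⟩).hasDerivWithinAt)
        (fun x hx => by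
          have hx' : x ∈ Set.Ico (0:ℝ) (1/2) := ⟨by linarith [hx.1], by linarith [hx.2, hr.2]⟩
          refine ((hc x hx').2.2).trans ?_
          refine mul_le_mul_of_nonneg_left ?_ c0
          have := hmono hx' (sub hr) hx.2
          have h0 := hnn x hx'
          exact pow_le_pow_left₀ (by linarith [hx'.1]) (by linarith [hx.2]) 2)
        ⟨le_rfl, hge⟩ ⟨hge, le_rfl⟩
      rw [hloc2 (1/20) (by norm_num)] at key
      simp only [sub_zero, Real.norm_eq_abs] at key
      refine key.trans ?_
      rw [abs_of_nonneg (by linarith)]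
      refine mul_le_of_le_one_right (by positivity) (by linarith [hr.2])

namespace PxH
variable {h : ℝ → ℝ} {c : ℝ}

theorem Rpos (H : PxH h c) {r : ℝ} (hr : r ∈ Set.Ioo (0:ℝ) (1/2)) : 0 < r + h r := by
  linarith [hr.1, H.nn r hr]

theorem Rmono (H : PxH h c) {r r' : ℝ} (hr : r ∈ Set.Ioo (0:ℝ) (1/2))
    (hr' : r' ∈ Set.Ioo (0:ℝ) (1/2)) (hle : r ≤ r') : h r ≤ h r' :=
  H.mono ⟨hr.1.le, hr.2⟩ ⟨hr'.1.le, hr'.2⟩ hle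

theorem low (H : PxH h c) {r₀ : ℝ} (hr₀ : r₀ ∈ Set.Ioo (0:ℝ) (1/2)) :
    ∃ M : ℝ, 1 ≤ M ∧ (∀ r ∈ Set.Ioc (0:ℝ) r₀, deriv h r ≤ M) ∧
      (∀ r ∈ Set.Ioc (0:ℝ) r₀, r + h r ≤ M * r) ∧
      (∀ r ∈ Set.Ioc (0:ℝ) r₀, r + h r ≤ M) ∧
      (∀ r ∈ Set.Ioc (0:ℝ) r₀, ∀ r' ∈ Set.Ioc (0:ℝ) r₀, |h r' - h r| ≤ M * |r' - r|) ∧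
      (∀ r ∈ Set.Ioc (0:ℝ) r₀, ∀ r' ∈ Set.Ioc (0:ℝ) r₀,
        |deriv h r' - deriv h r| ≤ M * |r' - r|) := by
  have sub : Set.Ioc (0:ℝ) r₀ ⊆ Set.Ioo (0:ℝ) (1/2) := fun r hr => ⟨hr.1, hr.2.trans_lt hr₀.2⟩
  set R := r₀ + h r₀ with hR
  have hRp : 0 < R := H.Rpos hr₀
  have hle : ∀ r ∈ Set.Ioc (0:ℝ) r₀, r + h r ≤ R := fun r hr => by
    linarith [H.Rmono (sub hr) hr₀ hr.2, hr.2]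
  have c0 := H.c0
  set M := 1 + 10 * R + c * R ^ 3 + c * R ^ 2 with hM
  have p1 : 0 ≤ c * R ^ 3 := by positivity
  have p2 : 0 ≤ c * R ^ 2 := by positivity
  have hM1 : 1 ≤ M := by linarith
  have hd : ∀ r ∈ Set.Ioc (0:ℝ) r₀, deriv h r ≤ M := by
    intro r hr
    have h1 := H.h1sq r (sub hr)
    have h2 : c * (r + h r) ^ 3 ≤ c * R ^ 3 :=
      mul_le_mul_of_nonneg_left (pow_le_pow_left₀ (H.Rpos (sub hr)).le (hle r hr) 3) c0
    nlinarith [sq_nonneg (deriv h r - 1), H.h1nn r (sub hr)]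
  have hd2 : ∀ r ∈ Set.Ioc (0:ℝ) r₀, |deriv (deriv h) r| ≤ M := by
    intro r hr
    have h1 := H.h2le r (sub hr)
    have h2 : c * (r + h r) ^ 2 ≤ c * R ^ 2 :=
      mul_le_mul_of_nonneg_left (pow_le_pow_left₀ (H.Rpos (sub hr)).le (hle r hr) 2) c0
    linarith
  refine ⟨M, hM1, hd, ?_, fun r hr => by linarith [hle r hr], ?_, ?_⟩
  · intro r hr
    rcases le_or_gt r (1/10) with hl | hl
    · rw [H.zero r ⟨hr.1, hl⟩]
      nlinarith [hr.1]
    · have := hle r hr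
      nlinarith
  · intro r hr r' hr'
    exact (convex_Ioc (0:ℝ) r₀).norm_image_sub_le_of_norm_hasDerivWithin_le
      (fun x hx => (H.d1 x (sub hx)).hasDerivWithinAt)
      (fun x hx => by
        rw [Real.norm_eq_abs, abs_of_nonneg (H.h1nn x (sub hx))]; exact hd x hx) hr hr'
  · intro r hr r' hr'
    exact (convex_Ioc (0:ℝ) r₀).norm_image_sub_le_of_norm_hasDerivWithin_le
      (fun x hx => (H.d2 x (sub hx)).hasDerivWithinAt)
      (fun x hx => hd2 x hx) hr hr'

theorem arccos_lip (H : PxH h c) {r₀ : ℝ} (hr₀ : r₀ ∈ Set.Ioo (0:ℝ) (1/2)) :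
    ∃ M : ℝ, 1 ≤ M ∧ ∀ r ∈ Set.Ioc (0:ℝ) r₀, ∀ r' ∈ Set.Ioc (0:ℝ) r₀,
      |Real.arccos (h r' / (h r' + r')) - Real.arccos (h r / (h r + r))| ≤ M * |r' - r| := by
  obtain ⟨M, hM1, hd, hRr, -, -, -⟩ := H.low hr₀
  have sub : Set.Ioc (0:ℝ) r₀ ⊆ Set.Ioo (0:ℝ) (1/2) := fun r hr => ⟨hr.1, hr.2.trans_lt hr₀.2⟩
  have hder : ∀ r ∈ Set.Ioc (0:ℝ) r₀, HasDerivAt (fun r => Real.arccos (h r / (h r + r)))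
      (-(1 / Real.sqrt (1 - (h r / (h r + r)) ^ 2)) *
        ((deriv h r * (h r + r) - h r * (deriv h r + 1)) / (h r + r) ^ 2)) r := by
    intro r hr
    have hr' := sub hr
    have hp : 0 < h r + r := by linarith [H.Rpos hr']
    have hn := H.nn r hr'
    have h1 := H.d1 r hr'
    have h2 : HasDerivAt (fun r => h r / (h r + r))
        ((deriv h r * (h r + r) - h r * (deriv h r + 1)) / (h r + r) ^ 2) r :=
      h1.div (h1.add (hasDerivAt_id r)) (by simpa using hp.ne')
    have h3 : h r / (h r + r) < 1 := by rw [div_lt_one hp]; linarith [hr.1]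
    have h4 : 0 ≤ h r / (h r + r) := by positivity
    have h5 := (Real.hasDerivAt_arccos (x := h r / (h r + r)) (by linarith) (by linarith))
    exact HasDerivAt.comp (h₂ := Real.arccos) r h5 h2
  refine ⟨M * (M + 10 * M), by nlinarith, ?_⟩
  intro r hr r' hr'
  refine (convex_Ioc (0:ℝ) r₀).norm_image_sub_le_of_norm_hasDerivWithin_le
      (f := fun r => Real.arccos (h r / (h r + r)))
      (fun x hx => (hder x hx).hasDerivWithinAt)
      (fun x hx => ?_) hr hr'
  have hx' := sub hx
  have hp : 0 < h x + x := by linarith [H.Rpos hx']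
  have hn := H.nn x hx'
  have hd0 := H.h1nn x hx'
  have hx0 := hx.1
  have hRx := hRr x hx
  have e1 : (x / (h x + x)) ≤ Real.sqrt (1 - (h x / (h x + x)) ^ 2) := by
    apply Real.le_sqrt_of_sq_le
    rw [div_pow, div_pow, le_sub_iff_add_le, ← add_div, div_le_one (by positivity)]
    nlinarith [mul_nonneg hn hx0.le]
  have e2 : 1 / Real.sqrt (1 - (h x / (h x + x)) ^ 2) ≤ M := by
    refine (one_div_le_one_div_of_le (by positivity) e1).trans ?_
    rw [one_div_div, div_le_iff₀ hx0]
    linarith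
  have e3 : |(deriv h x * (h x + x) - h x * (deriv h x + 1)) / (h x + x) ^ 2| ≤ M + 10 * M := by
    rcases lt_or_ge x (1/10) with hl | hl
    · have z : deriv h x = 0 := by
        have : h =ᶠ[nhds x] fun _ => 0 := by
          filter_upwards [isOpen_Ioo.mem_nhds (show x ∈ Set.Ioo (0:ℝ) (1/10) from ⟨hx0, hl⟩)]
            with y hy
          exact H.zero y ⟨hy.1, hy.2.le⟩
        rw [this.deriv_eq]; simp
      rw [z, H.zero x ⟨hx0, hl.le⟩]
      simp
      linarith
    · have hdx := hd x hx
      rw [abs_div, abs_of_pos (a := (h x + x) ^ 2) (by positivity), div_le_iff₀ (by positivity),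
        abs_le]
      have hb : 1/10 ≤ h x + x := by linarith
      have b1 : deriv h x * x ≤ M * x := mul_le_mul_of_nonneg_right hdx hx0.le
      have b2 : 0 ≤ deriv h x * x := by positivity
      have b3 : (h x + x) * (1/10) ≤ (h x + x) ^ 2 := by nlinarith
      constructor <;> nlinarith
  rw [norm_mul, norm_neg, Real.norm_eq_abs, Real.norm_eq_abs,
    abs_of_nonneg (a := 1 / Real.sqrt (1 - (h x / (h x + x)) ^ 2)) (by positivity)]
  exact mul_le_mul e2 e3 (abs_nonneg _) (by linarith)

end PxH

theorem px_lip2 {I : Set ℝ} (hI : Convex ℝ I) {f fr fs : ℝ → ℝ → ℝ} {b M : ℝ}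
    (hr : ∀ r ∈ I, ∀ s, |s| ≤ b → HasDerivAt (fun r => f r s) (fr r s) r)
    (hs : ∀ r ∈ I, ∀ s, |s| ≤ b → HasDerivAt (f r) (fs r s) s)
    (hrM : ∀ r ∈ I, ∀ s, |s| ≤ b → |fr r s| ≤ M)
    (hsM : ∀ r ∈ I, ∀ s, |s| ≤ b → |fs r s| ≤ M) :
    ∀ r ∈ I, ∀ r' ∈ I, ∀ s s', |s| ≤ b → |s'| ≤ b →
      |f r' s' - f r s| ≤ M * (|r' - r| + |s' - s|) := by
  intro r h1 r' h2 s s' h3 h4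
  have a1 : |f r' s' - f r s'| ≤ M * |r' - r| :=
    hI.norm_image_sub_le_of_norm_hasDerivWithin_le (f := fun r => f r s')
      (fun x hx => (hr x hx s' h4).hasDerivWithinAt) (fun x hx => hrM x hx s' h4) h1 h2
  have a2 : |f r s' - f r s| ≤ M * |s' - s| :=
    (convex_Icc (-b) b).norm_image_sub_le_of_norm_hasDerivWithin_le (f := fun s => f r s)
      (fun x hx => (hs r h1 x (abs_le.2 hx)).hasDerivWithinAt)
      (fun x hx => hsM r h1 x (abs_le.2 hx)) (abs_le.1 h3) (abs_le.1 h4)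
  have := abs_sub_le (f r' s') (f r s') (f r s)
  linarith

/-- `√(R² - s²)`. -/
def pxD (h : ℝ → ℝ) (r s : ℝ) : ℝ := Real.sqrt ((r + h r) ^ 2 - s ^ 2)
/-- The primitive of the weight in the `(r, x₁ - 1/2)` coordinates. -/
def pxF (h : ℝ → ℝ) (r s : ℝ) : ℝ :=
  (r + h r) * (1 + deriv h r) * Real.arcsin (s / (r + h r)) - deriv h r * s
/-- The weight in the `(r, x₁ - 1/2)` coordinates. -/
def pxq (h : ℝ → ℝ) (r s : ℝ) : ℝ := 1 + (1 + deriv h r) * ((r + h r) / pxD h r s - 1)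
/-- The slope of the arcs. -/
def pxp (h : ℝ → ℝ) (r s : ℝ) : ℝ := -s / pxD h r s
/-- The height of the arcs. -/
def pxX (h : ℝ → ℝ) (r s : ℝ) : ℝ := pxD h r s - h r

namespace PxH
variable {h : ℝ → ℝ} {c : ℝ}

theorem basics (H : PxH h c) {r₀ : ℝ} (hr₀ : r₀ ∈ Set.Ioo (0:ℝ) (1/2))
    (hr₀eq : 2 * r₀ * h r₀ + r₀ ^ 2 = 1/4) :
    ∃ κ : ℝ, 0 < κ ∧ κ ≤ 1 ∧ ∀ r ∈ Set.Ico r₀ (1/2), ∀ s : ℝ, |s| ≤ 1/2 →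
      1/2 < r + h r ∧ κ * (r + h r) ≤ pxD h r s ∧ pxD h r s ^ 2 = (r + h r) ^ 2 - s ^ 2 ∧
      pxD h r s ≤ r + h r := by
  have hR := H.Rpos hr₀
  set R₀ := r₀ + h r₀ with hR₀
  have hh0 : 0 < h r₀ := by
    have := hr₀.1
    have := hr₀.2
    by_contra hcon
    push Not at hcon
    nlinarith
  have hRsq : R₀ ^ 2 = 1/4 + (h r₀) ^ 2 := by rw [hR₀]; linarith
  have hR12 : 1/2 < R₀ := by nlinarith
  set κ := h r₀ / R₀ with hκ
  have hκ0 : 0 < κ := by positivity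
  have hκ1 : κ ≤ 1 := by rw [hκ, div_le_one hR]; linarith [hr₀.1]
  refine ⟨κ, hκ0, hκ1, ?_⟩
  intro r hr s hs
  have hr' : r ∈ Set.Ioo (0:ℝ) (1/2) := ⟨hr₀.1.trans_le hr.1, hr.2⟩
  have hRle : R₀ ≤ r + h r := by linarith [H.Rmono hr₀ hr' hr.1, hr.1]
  have hs2 : s ^ 2 ≤ 1/4 := by
    have := abs_le.1 hs; nlinarith
  have hRp := H.Rpos hr'
  have hκsq : κ ^ 2 * R₀ ^ 2 = h r₀ ^ 2 := by rw [hκ]; field_simp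
  have hnn : (κ * (r + h r)) ^ 2 ≤ (r + h r) ^ 2 - s ^ 2 := by
    have hk2 : κ ^ 2 ≤ 1 := by nlinarith
    have : R₀ ^ 2 ≤ (r + h r) ^ 2 := pow_le_pow_left₀ hR.le hRle 2
    rw [mul_pow]
    nlinarith
  refine ⟨by linarith, Real.le_sqrt_of_sq_le hnn, Real.sq_sqrt ((sq_nonneg _).trans hnn), ?_⟩
  rw [pxD, Real.sqrt_le_left hRp.le]
  linarith [sq_nonneg s]

theorem deriv_bounds (H : PxH h c) {r : ℝ} (hr : r ∈ Set.Ioo (0:ℝ) (1/2))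
    (hR : 1/2 < r + h r) :
    (1 + deriv h r) ^ 2 ≤ (16 + 2 * c) * (r + h r) ^ 3 ∧
    1 + deriv h r ≤ 2 * (16 + 2 * c) * (r + h r) ^ 2 := by
  have h1 := H.h1sq r hr
  have h0 := H.h1nn r hr
  have c0 := H.c0
  set R := r + h r
  have h3 : (1/2:ℝ) ^ 3 ≤ R ^ 3 := pow_le_pow_left₀ (by norm_num) hR.le 3
  have a : (1 + deriv h r) ^ 2 ≤ (16 + 2 * c) * R ^ 3 := by
    nlinarith [sq_nonneg (deriv h r - 1)]
  refine ⟨a, ?_⟩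
  refine abs_le_of_sq_le_sq' ?_ (by positivity) |>.2
  refine a.trans ?_
  have : R ^ 3 ≤ 2 * R ^ 4 := by
    have : 0 ≤ R ^ 3 := by positivity
    nlinarith
  have h4 : 0 ≤ R ^ 4 := by positivity
  nlinarith [mul_nonneg c0 h4, mul_nonneg (mul_nonneg c0 c0) h4]

end PxH

namespace PxH
variable {h : ℝ → ℝ} {c : ℝ}

theorem dD_s {r s : ℝ} (hD : 0 < pxD h r s) : HasDerivAt (pxD h r) (-s / pxD h r s) s := by
  have h1 : HasDerivAt (fun s : ℝ => (r + h r) ^ 2 - s ^ 2) (-(2 * s)) s := by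
    simpa using ((hasDerivAt_id s).pow 2).const_sub ((r + h r) ^ 2)
  have hne : (r + h r) ^ 2 - s ^ 2 ≠ 0 := by
    intro h0; rw [pxD, h0, Real.sqrt_zero] at hD; exact lt_irrefl _ hD
  have h2 := h1.sqrt hne
  have : -s / pxD h r s = -(2 * s) / (2 * Real.sqrt ((r + h r) ^ 2 - s ^ 2)) := by
    rw [pxD]
    rw [← mul_neg, mul_div_mul_left _ _ two_ne_zero]
  rw [this]
  exact h2

theorem dD_r (H : PxH h c) {r s : ℝ} (hr : r ∈ Set.Ioo (0:ℝ) (1/2)) (hD : 0 < pxD h r s) :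
    HasDerivAt (fun r => pxD h r s) ((r + h r) * (1 + deriv h r) / pxD h r s) r := by
  have h0 : HasDerivAt (fun r => r + h r) (1 + deriv h r) r := (hasDerivAt_id r).add (H.d1 r hr)
  have h1 : HasDerivAt (fun r : ℝ => (r + h r) ^ 2 - s ^ 2)
      (2 * ((r + h r) * (1 + deriv h r))) r := by
    have := (h0.pow 2).sub_const (s ^ 2)
    refine HasDerivAt.congr_deriv this ?_
    push_cast; ring
  have hne : (r + h r) ^ 2 - s ^ 2 ≠ 0 := by
    intro h0; rw [pxD, h0, Real.sqrt_zero] at hD; exact lt_irrefl _ hD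
  have h2 := h1.sqrt hne
  rw [mul_div_mul_left _ _ two_ne_zero] at h2
  exact h2

theorem dF {r s : ℝ} (hR : 0 < r + h r) (hD : 0 < pxD h r s)
    (hDsq : pxD h r s ^ 2 = (r + h r) ^ 2 - s ^ 2) :
    HasDerivAt (pxF h r) (pxq h r s) s := by
  have hlt : s ^ 2 < (r + h r) ^ 2 := by nlinarith
  have habs := abs_lt_of_sq_lt_sq' hlt hR.le
  have h1 : -1 < s / (r + h r) := by rw [lt_div_iff₀ hR]; linarith [habs.1]
  have h2 : s / (r + h r) < 1 := by rw [div_lt_one hR]; exact habs.2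
  have h3 : HasDerivAt (fun s => s / (r + h r)) (1 / (r + h r)) s :=
    (hasDerivAt_id s).div_const _
  have h4 := HasDerivAt.comp (h₂ := Real.arcsin) s (Real.hasDerivAt_arcsin (by linarith) (by linarith)) h3
  have h5 := (h4.const_mul ((r + h r) * (1 + deriv h r))).sub
    ((hasDerivAt_id s).const_mul (deriv h r))
  have hs : Real.sqrt (1 - (s / (r + h r)) ^ 2) = pxD h r s / (r + h r) := by
    rw [Real.sqrt_eq_iff_mul_self_eq_of_pos (by positivity), ← sq, div_pow, hDsq]
    field_simp
  rw [hs] at h5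
  refine HasDerivAt.congr_deriv (f := pxF h r) h5 ?_
  rw [pxq]
  field_simp
  ring

theorem dq_s {r s : ℝ} (hD : 0 < pxD h r s) :
    HasDerivAt (pxq h r) ((1 + deriv h r) * ((r + h r) * s / pxD h r s ^ 3)) s := by
  have h1 := (((hasDerivAt_const s (r + h r)).div (dD_s hD) hD.ne').sub_const 1).const_mul
    (1 + deriv h r) |>.const_add 1
  refine HasDerivAt.congr_deriv (f := pxq h r) h1 ?_
  field_simp
  ring

theorem dq_r (H : PxH h c) {r s : ℝ} (hr : r ∈ Set.Ioo (0:ℝ) (1/2)) (hD : 0 < pxD h r s)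
    (hDsq : pxD h r s ^ 2 = (r + h r) ^ 2 - s ^ 2) :
    HasDerivAt (fun r => pxq h r s) (deriv (deriv h) r * ((r + h r) / pxD h r s - 1)
      - (1 + deriv h r) ^ 2 * (s ^ 2 / pxD h r s ^ 3)) r := by
  have h0 : HasDerivAt (fun r => r + h r) (1 + deriv h r) r := (hasDerivAt_id r).add (H.d1 r hr)
  have h1 := (((H.d2 r hr).const_add 1).mul ((h0.div (H.dD_r hr hD) hD.ne').sub_const 1)).const_add 1
  refine HasDerivAt.congr_deriv (f := fun r => pxq h r s) h1 ?_
  have : s ^ 2 = (r + h r) ^ 2 - pxD h r s ^ 2 := by linarith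
  rw [this]
  simp only [Pi.div_apply]
  field_simp
  ring

theorem dp_s {r s : ℝ} (hD : 0 < pxD h r s)
    (hDsq : pxD h r s ^ 2 = (r + h r) ^ 2 - s ^ 2) :
    HasDerivAt (pxp h r) (-(r + h r) ^ 2 / pxD h r s ^ 3) s := by
  have h1 := (hasDerivAt_id s).neg.div (dD_s hD) hD.ne'
  refine HasDerivAt.congr_deriv (f := pxp h r) h1 ?_
  have : (r + h r) ^ 2 = pxD h r s ^ 2 + s ^ 2 := by linarith
  rw [this]
  simp only [Pi.neg_apply, id]
  field_simp
  ring

theorem dp_r (H : PxH h c) {r s : ℝ} (hr : r ∈ Set.Ioo (0:ℝ) (1/2)) (hD : 0 < pxD h r s) :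
    HasDerivAt (fun r => pxp h r s)
      ((1 + deriv h r) * ((r + h r) * s / pxD h r s ^ 3)) r := by
  have h1 := (hasDerivAt_const r (-s)).div (H.dD_r hr hD) hD.ne'
  refine HasDerivAt.congr_deriv (f := fun r => pxp h r s) h1 ?_
  field_simp
  ring

theorem dX {r s : ℝ} (hD : 0 < pxD h r s) : HasDerivAt (pxX h r) (pxp h r s) s :=
  (dD_s hD).sub_const (h r)

/-- all the bounds in the upper region -/
theorem high (H : PxH h c) {r₀ : ℝ} (hr₀ : r₀ ∈ Set.Ioo (0:ℝ) (1/2))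
    (hr₀eq : 2 * r₀ * h r₀ + r₀ ^ 2 = 1/4) :
    ∃ M : ℝ, 1 ≤ M ∧
    (∀ r ∈ Set.Ico r₀ (1/2), ∀ s, |s| ≤ 1/2 → HasDerivAt (pxF h r) (pxq h r s) s) ∧
    (∀ r ∈ Set.Ico r₀ (1/2), ∀ s, |s| ≤ 1/2 → 1 ≤ pxq h r s) ∧
    (∀ r ∈ Set.Ico r₀ (1/2), ∀ s, |s| ≤ 1/2 → pxq h r s ≤ M) ∧
    (∀ r ∈ Set.Ico r₀ (1/2), ∀ r' ∈ Set.Ico r₀ (1/2), ∀ s s', |s| ≤ 1/2 → |s'| ≤ 1/2 →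
      |pxq h r' s' - pxq h r s| ≤ M * (|r' - r| + |s' - s|)) ∧
    (∀ r ∈ Set.Ico r₀ (1/2), ∀ s, |s| ≤ 1/2 → HasDerivAt (pxX h r) (pxp h r s) s) ∧
    (∀ r ∈ Set.Ico r₀ (1/2), ∀ s, |s| ≤ 1/2 → |pxp h r s| ≤ M) ∧
    (∀ r ∈ Set.Ico r₀ (1/2), ∀ r' ∈ Set.Ico r₀ (1/2), ∀ s s', |s| ≤ 1/2 → |s'| ≤ 1/2 →
      |pxp h r' s' - pxp h r s| ≤ M * (|r' - r| + |s' - s|)) ∧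
    (∀ ε > 0, ∀ᶠ r in nhdsWithin (1/2 : ℝ) (Set.Iio (1/2 : ℝ)), ∀ s, |s| ≤ 1/2 →
      pxq h r s - 1 ≤ ε ∧ |pxp h r s| ≤ ε) := by
  obtain ⟨κ, hκ0, hκ1, hb⟩ := H.basics hr₀ hr₀eq
  have c0 := H.c0
  set N := 16 + 2 * c with hN
  set a := 1 / κ with ha
  have ha1 : 1 ≤ a := by rw [ha, le_div_iff₀ hκ0]; linarith
  have sub : Set.Ico r₀ (1/2) ⊆ Set.Ioo (0:ℝ) (1/2) := fun r hr => ⟨hr₀.1.trans_le hr.1, hr.2⟩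
  have Dpos : ∀ r ∈ Set.Ico r₀ (1/2), ∀ s, |s| ≤ 1/2 → 0 < pxD h r s := fun r hr s hs =>
    (mul_pos hκ0 (H.Rpos (sub hr))).trans_le (hb r hr s hs).2.1
  have invD : ∀ r ∈ Set.Ico r₀ (1/2), ∀ s, |s| ≤ 1/2 → 1 / pxD h r s ≤ a / (r + h r) := by
    intro r hr s hs
    have h1 := (hb r hr s hs).2.1
    have hR := H.Rpos (sub hr)
    rw [ha, div_div]
    exact one_div_le_one_div_of_le (by positivity) h1
  have invD3 : ∀ r ∈ Set.Ico r₀ (1/2), ∀ s, |s| ≤ 1/2 →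
      1 / pxD h r s ^ 3 ≤ a ^ 3 / (r + h r) ^ 3 := by
    intro r hr s hs
    have h1 := invD r hr s hs
    have hD := Dpos r hr s hs
    have := pow_le_pow_left₀ (by positivity) h1 3
    simpa [div_pow] using this
  have ratio : ∀ r ∈ Set.Ico r₀ (1/2), ∀ s, |s| ≤ 1/2 →
      0 ≤ (r + h r) / pxD h r s - 1 ∧ (r + h r) / pxD h r s - 1 ≤ a / (4 * (r + h r) ^ 2) := by
    intro r hr s hs
    obtain ⟨h1, h2, h3, h4⟩ := hb r hr s hs
    have hD := Dpos r hr s hs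
    have hR := H.Rpos (sub hr)
    have e : (r + h r) / pxD h r s - 1 = (r + h r - pxD h r s) * (1 / pxD h r s) := by
      field_simp
    have hs2 : s ^ 2 ≤ 1/4 := by
      have := abs_le.1 hs; nlinarith
    have e2 : r + h r - pxD h r s ≤ 1 / (4 * (r + h r)) := by
      rw [le_div_iff₀ (by positivity)]
      nlinarith
    have e3 := invD r hr s hs
    rw [e]
    constructor
    · exact mul_nonneg (by linarith) (by positivity)
    · calc _ ≤ 1 / (4 * (r + h r)) * (a / (r + h r)) :=
          mul_le_mul e2 e3 (by positivity) (by positivity)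
        _ = _ := by field_simp
  have qs : ∀ r ∈ Set.Ico r₀ (1/2), ∀ s, |s| ≤ 1/2 →
      |(1 + deriv h r) * ((r + h r) * s / pxD h r s ^ 3)| ≤ N * a ^ 3 := by
    intro r hr s hs
    obtain ⟨h1, h2, h3, h4⟩ := hb r hr s hs
    have hD := Dpos r hr s hs
    have hR := H.Rpos (sub hr)
    have d0 := H.h1nn r (sub hr)
    have db := (H.deriv_bounds (sub hr) h1).2
    rw [← hN] at db
    have i3 := invD3 r hr s hs
    have e : |(1 + deriv h r) * ((r + h r) * s / pxD h r s ^ 3)| =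
        (1 + deriv h r) * (r + h r) * |s| * (1 / pxD h r s ^ 3) := by
      rw [abs_mul, abs_div, abs_mul, abs_of_nonneg (show 0 ≤ 1 + deriv h r by linarith),
        abs_of_pos hR, abs_of_pos (show 0 < pxD h r s ^ 3 by positivity)]
      ring
    rw [e]
    calc _ ≤ (2 * N * (r + h r) ^ 2) * (r + h r) * (1/2) * (a ^ 3 / (r + h r) ^ 3) := by
          gcongr
      _ = _ := by field_simp
  have N0 : 16 ≤ N := by linarith
  have hM0 : 0 ≤ N * a + c * a := by positivity
  have hM2 : 1 ≤ a ^ 3 := one_le_pow₀ ha1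
  set M := 1 + a + N * a + c * a + N * a ^ 3 with hM
  have hMa : N * a ^ 3 ≤ M := by linarith
  have hNa : 0 ≤ N * a := by positivity
  have hca : 0 ≤ c * a := by positivity
  have hNa3 : 0 ≤ N * a ^ 3 := by positivity
  have qub : ∀ r ∈ Set.Ico r₀ (1/2), ∀ s, |s| ≤ 1/2 →
      pxq h r s - 1 ≤ a * ((1 + deriv h r) / (r + h r) ^ 2) := by
    intro r hr s hs
    have hR := H.Rpos (sub hr)
    have d0 := H.h1nn r (sub hr)
    have h2 := (ratio r hr s hs).2
    rw [pxq]
    calc _ = (1 + deriv h r) * ((r + h r) / pxD h r s - 1) := by ring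
      _ ≤ (1 + deriv h r) * (a / (4 * (r + h r) ^ 2)) := by gcongr
      _ = a * ((1 + deriv h r) / (r + h r) ^ 2) / 4 := by field_simp
      _ ≤ _ := by
        have : 0 ≤ a * ((1 + deriv h r) / (r + h r) ^ 2) := by positivity
        linarith
  have pub : ∀ r ∈ Set.Ico r₀ (1/2), ∀ s, |s| ≤ 1/2 → |pxp h r s| ≤ a / (2 * (r + h r)) := by
    intro r hr s hs
    have hR := H.Rpos (sub hr)
    have hD := Dpos r hr s hs
    have i1 := invD r hr s hs
    rw [pxp, abs_div, abs_neg, abs_of_pos hD]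
    calc _ = |s| * (1 / pxD h r s) := by ring
      _ ≤ (1/2) * (a / (r + h r)) := by gcongr
      _ = _ := by field_simp
  refine ⟨M, by linarith, ?_, ?_, ?_, ?_, ?_, ?_, ?_, ?_⟩
  · intro r hr s hs
    exact dF (H.Rpos (sub hr)) (Dpos r hr s hs) (hb r hr s hs).2.2.1
  · intro r hr s hs
    have := (ratio r hr s hs).1
    have d0 := H.h1nn r (sub hr)
    rw [pxq]
    have : 0 ≤ (1 + deriv h r) * ((r + h r) / pxD h r s - 1) := mul_nonneg (by linarith) this
    linarith
  · intro r hr s hs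
    have h1 := qub r hr s hs
    have hR := H.Rpos (sub hr)
    have db := (H.deriv_bounds (sub hr) (hb r hr s hs).1).2
    rw [← hN] at db
    have h2 : (1 + deriv h r) / (r + h r) ^ 2 ≤ 2 * N := by
      rw [div_le_iff₀ (by positivity)]; exact db
    have h3 : a * ((1 + deriv h r) / (r + h r) ^ 2) ≤ a * (2 * N) := by gcongr
    have h4 : N * a ≤ N * a ^ 3 := by
      gcongr
      exact le_self_pow₀ ha1 (by norm_num)
    linarith
  · refine px_lip2 (convex_Ico _ _) (fun r hr s hs => H.dq_r (sub hr) (Dpos r hr s hs)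
      (hb r hr s hs).2.2.1) (fun r hr s hs => dq_s (Dpos r hr s hs)) ?_
      (fun r hr s hs => (qs r hr s hs).trans hMa)
    intro r hr s hs
    have hR := H.Rpos (sub hr)
    have hD := Dpos r hr s hs
    obtain ⟨ra, rb⟩ := ratio r hr s hs
    have db := (H.deriv_bounds (sub hr) (hb r hr s hs).1).1
    rw [← hN] at db
    have i3 := invD3 r hr s hs
    have hs2 : s ^ 2 ≤ 1/4 := by
      have := abs_le.1 hs; nlinarith
    have e1 : |deriv (deriv h) r * ((r + h r) / pxD h r s - 1)| ≤ c * a := by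
      rw [abs_mul, abs_of_nonneg ra]
      have := H.h2le r (sub hr)
      calc _ ≤ (c * (r + h r) ^ 2) * (a / (4 * (r + h r) ^ 2)) := by gcongr
        _ = c * a / 4 := by field_simp
        _ ≤ _ := by linarith
    have e2 : |(1 + deriv h r) ^ 2 * (s ^ 2 / pxD h r s ^ 3)| ≤ N * a ^ 3 := by
      rw [abs_of_nonneg (by positivity)]
      calc _ = (1 + deriv h r) ^ 2 * s ^ 2 * (1 / pxD h r s ^ 3) := by ring
        _ ≤ (N * (r + h r) ^ 3) * (1/4) * (a ^ 3 / (r + h r) ^ 3) := by gcongr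
        _ = N * a ^ 3 / 4 := by field_simp
        _ ≤ _ := by linarith
    refine (abs_sub _ _).trans ?_
    linarith
  · intro r hr s hs
    exact dX (Dpos r hr s hs)
  · intro r hr s hs
    have h1 := pub r hr s hs
    have hR := (hb r hr s hs).1
    refine h1.trans ?_
    rw [div_le_iff₀ (by linarith)]
    have : a ≤ M := by linarith
    nlinarith
  · refine px_lip2 (convex_Ico _ _) (fun r hr s hs => H.dp_r (sub hr) (Dpos r hr s hs))
      (fun r hr s hs => dp_s (Dpos r hr s hs) (hb r hr s hs).2.2.1)
      (fun r hr s hs => (qs r hr s hs).trans hMa) ?_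
    intro r hr s hs
    have hR := H.Rpos (sub hr)
    have hR2 := (hb r hr s hs).1
    have hD := Dpos r hr s hs
    have i3 := invD3 r hr s hs
    rw [abs_div, abs_neg, abs_of_nonneg (sq_nonneg (r + h r)), abs_of_pos (show 0 < pxD h r s ^ 3 by positivity)]
    calc _ = (r + h r) ^ 2 * (1 / pxD h r s ^ 3) := by ring
      _ ≤ (r + h r) ^ 2 * (a ^ 3 / (r + h r) ^ 3) := by gcongr
      _ = a ^ 3 / (r + h r) := by field_simp
      _ ≤ N * a ^ 3 := by
        rw [div_le_iff₀ hR]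
        have : 0 < a ^ 3 := by linarith
        nlinarith
      _ ≤ M := hMa
  · intro ε hε
    have ev1 : ∀ᶠ r in nhdsWithin (1/2 : ℝ) (Set.Iio (1/2 : ℝ)), r ∈ Set.Ico r₀ (1/2) :=
      Ico_mem_nhdsLT hr₀.2
    have ev2 := H.lim.eventually_ge_atTop (a ^ 2 * N / ε ^ 2 + a / ε)
    filter_upwards [ev1, ev2] with r hr hge s hs
    have hr0 := (sub hr).1
    have hR := H.Rpos (sub hr)
    have q1 : 0 ≤ a ^ 2 * N / ε ^ 2 := by positivity
    have q2 : 0 ≤ a / ε := by positivity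
    have hA : a ^ 2 * N / ε ^ 2 ≤ r + h r := by linarith
    have hB : a / ε ≤ r + h r := by linarith
    constructor
    · refine (qub r hr s hs).trans ?_
      have db := (H.deriv_bounds (sub hr) (hb r hr s hs).1).1
      rw [← hN] at db
      refine (abs_le_of_sq_le_sq' ?_ hε.le).2
      rw [div_le_iff₀ (by positivity)] at hA
      rw [mul_pow, div_pow (1 + deriv h r), ← mul_div_assoc, div_le_iff₀ (by positivity)]
      calc a ^ 2 * (1 + deriv h r) ^ 2 ≤ a ^ 2 * (N * (r + h r) ^ 3) := by gcongr
        _ = (a ^ 2 * N) * (r + h r) ^ 3 := by ring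
        _ ≤ ((r + h r) * ε ^ 2) * (r + h r) ^ 3 := by gcongr
        _ = _ := by ring
    · refine (pub r hr s hs).trans ?_
      rw [div_le_iff₀ hε] at hB
      rw [div_le_iff₀ (by positivity)]
      nlinarith

end PxH

/-- The plane as `ℂ`. -/
def pxc (x : ℝ × ℝ) : ℂ := ⟨x.1, x.2⟩

/-- The primitive of the weight in the angle coordinate. -/
def pxW (h : ℝ → ℝ) (r φ : ℝ) : ℝ := (1 + deriv h r) * φ - deriv h r * Real.sin φ

theorem pxW_deriv (h : ℝ → ℝ) (r φ : ℝ) :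
    HasDerivAt (pxW h r) (1 + deriv h r - deriv h r * Real.cos φ) φ := by
  have := ((hasDerivAt_id φ).const_mul (1 + deriv h r)).sub
    ((Real.hasDerivAt_sin φ).const_mul (deriv h r))
  refine HasDerivAt.congr_deriv (f := pxW h r) this ?_
  ring

theorem pxW_neg (h : ℝ → ℝ) (r φ : ℝ) : pxW h r (-φ) = - pxW h r φ := by
  simp only [pxW, Real.sin_neg]; ring

theorem pxW_nonneg {h : ℝ → ℝ} {r φ : ℝ} (hd : 0 ≤ deriv h r) (hφ : 0 ≤ φ) : 0 ≤ pxW h r φ := by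
  have := mul_le_mul_of_nonneg_left (Real.sin_le hφ) hd
  rw [pxW]; linarith

theorem px_int (h Θ : ℝ → ℝ) (r a b : ℝ) :
    Θ r * ∫ θ in a..b, wgt h Θ r θ = pxW h r (b * Θ r) - pxW h r (a * Θ r) := by
  rw [← intervalIntegral.integral_const_mul]
  refine intervalIntegral.integral_eq_sub_of_hasDerivAt (f := fun θ => pxW h r (θ * Θ r)) ?_ ?_
  · intro θ _
    have h1 : HasDerivAt (fun θ => θ * Θ r) (Θ r) θ := by
      simpa using (hasDerivAt_id θ).mul_const (Θ r)
    have := HasDerivAt.comp (h₂ := pxW h r) θ (pxW_deriv h r (θ * Θ r)) h1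
    refine HasDerivAt.congr_deriv this ?_
    rw [wgt]; ring
  · apply Continuous.intervalIntegrable
    unfold wgt
    fun_prop

theorem px_rel {h Θ : ℝ → ℝ} {δ : ℝ} {g : ℝ → ℝ → ℝ} (hg : IsGFamily h Θ δ g) {r θ : ℝ}
    (hr : r ∈ Set.Ioo (0:ℝ) (1/2)) (hd : 0 ≤ deriv h r) (hΘ : 0 < Θ r)
    (hθ : θ ∈ Set.Icc (-1:ℝ) 1) :
    pxW h r (g r θ * Θ r) =
      pxW h r (θ * Θ r) + δ * (pxW h r (Θ r) - |pxW h r (θ * Θ r)|) := by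
  obtain ⟨-, -, -, -, h1, h2⟩ := hg r hr
  rcases le_total θ 0 with h0 | h0
  · have e := h1 θ ⟨hθ.1, h0⟩
    have e' : (1 + δ) * (Θ r * ∫ θ in (-1:ℝ)..θ, wgt h Θ r θ) =
        Θ r * ∫ θ in (-1:ℝ)..(g r θ), wgt h Θ r θ := by rw [← e]; ring
    rw [px_int, px_int] at e'
    have hm : pxW h r (-1 * Θ r) = - pxW h r (Θ r) := by rw [← pxW_neg]; ring_nf
    have hs : pxW h r (θ * Θ r) ≤ 0 := by
      have := pxW_nonneg hd (show 0 ≤ -(θ * Θ r) by nlinarith)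
      rw [pxW_neg] at this
      linarith
    rw [hm] at e'
    rw [abs_of_nonpos hs]
    linarith
  · have e := h2 θ ⟨h0, hθ.2⟩
    have e' : (1 - δ) * (Θ r * ∫ θ in θ..(1:ℝ), wgt h Θ r θ) =
        Θ r * ∫ θ in (g r θ)..(1:ℝ), wgt h Θ r θ := by rw [← e]; ring
    rw [px_int, px_int] at e'
    have hs : 0 ≤ pxW h r (θ * Θ r) := pxW_nonneg hd (by positivity)
    rw [one_mul] at e'
    rw [abs_of_nonneg hs]
    linarith

theorem px_theta {h Θ : ℝ → ℝ} {c r₀ : ℝ} (H : PxH h c) (hΘ : GoodTheta h r₀ Θ) {r : ℝ}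
    (hr : r ∈ Set.Ioo (0:ℝ) (1/2)) : 0 < Θ r ∧ Θ r ≤ Real.pi / 2 := by
  have hn := H.nn r hr
  have hR := H.Rpos hr
  rcases le_or_gt r r₀ with hl | hl
  · rw [hΘ.1 r hr.1 hl]
    constructor
    · rw [Real.arccos_pos, div_lt_one (by linarith)]; linarith [hr.1]
    · rw [Real.arccos_le_pi_div_two]
      exact div_nonneg hn (by linarith)
  · rw [hΘ.2 r hl hr.2]
    exact ⟨Real.arcsin_pos.2 (by have : 0 < h r + r := by linarith
                                 positivity), Real.arcsin_le_pi_div_two _⟩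

/-- Above `r₀` the angle is given by the arcsine (including at `r₀`). -/
theorem px_theta_high {h Θ : ℝ → ℝ} {c r₀ : ℝ} (H : PxH h c) (hΘ : GoodTheta h r₀ Θ) {r : ℝ}
    (hr₀ : r₀ ∈ Set.Ioo (0:ℝ) (1/2)) (hr₀eq : 2 * r₀ * h r₀ + r₀ ^ 2 = 1/4)
    (hr : r ∈ Set.Ico r₀ (1/2)) : Θ r = Real.arcsin ((1/2) / (r + h r)) := by
  rcases hr.1.eq_or_lt with he | hl
  · subst he
    have hn := H.nn r₀ hr₀
    have hR := H.Rpos hr₀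
    have hR' : 0 < h r₀ + r₀ := by linarith
    rw [hΘ.1 r₀ hr₀.1 le_rfl, Real.arccos_eq_arcsin (by positivity)]
    congr 1
    rw [Real.sqrt_eq_iff_mul_self_eq_of_pos (by positivity)]
    field_simp
    nlinarith
  · rw [hΘ.2 r hl hr.2]
    congr 1
    rw [div_div, add_comm]

/-- Data attached to a point `x` and its image `y`. -/
structure PxPt (h Θ : ℝ → ℝ) (δ : ℝ) (x y : ℝ × ℝ) (r φ ψ : ℝ) : Prop where
  hr : r ∈ Set.Ioo (0:ℝ) (1/2)
  hφ : |φ| ≤ Θ r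
  hψ : |ψ| ≤ Θ r
  hΘ : Θ r ≤ Real.pi / 2
  bx : |x.1 - 1/2| ≤ 1/2
  bY : |y.1 - 1/2| ≤ 1/2
  x1 : x.1 = 1/2 + (r + h r) * Real.sin φ
  x2 : x.2 = (r + h r) * Real.cos φ - h r
  y1 : y.1 = 1/2 + (r + h r) * Real.sin ψ
  y2 : y.2 = (r + h r) * Real.cos ψ - h r
  rel : pxW h r ψ = pxW h r φ + δ * (pxW h r (Θ r) - |pxW h r φ|)

theorem px_pt {h Θ : ℝ → ℝ} {c r₀ δ : ℝ} (H : PxH h c)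
    (hΘ : GoodTheta h r₀ Θ) {K : ℝ × ℝ → ℝ × ℝ} (hK : GoodK h Θ K) {g : ℝ → ℝ → ℝ}
    {Ψ : ℝ × ℝ → ℝ × ℝ} (hg : IsGFamily h Θ δ g) (hΨ : IsPsi K δ g Ψ) {x : ℝ × ℝ}
    (hx : x ∈ lowerDom) : ∃ φ ψ, PxPt h Θ δ x (Ψ x) (K x).1 φ ψ := by
  obtain ⟨hy, h1, h2⟩ := hΨ.1 x hx
  have kx := hK.1.mapsTo hx
  have ky := hK.1.mapsTo hy
  obtain ⟨ex1, ex2⟩ := hK.2 x hx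
  obtain ⟨ey1, ey2⟩ := hK.2 _ hy
  obtain ⟨ht0, ht1⟩ := px_theta H hΘ kx.1
  rw [h1] at ey1 ey2
  rw [h2] at ey1 ey2
  have ab : ∀ θ ∈ Set.Icc (-1:ℝ) 1, |θ * Θ (K x).1| ≤ Θ (K x).1 := by
    intro θ hθ
    rw [abs_mul, abs_of_pos ht0]
    exact mul_le_of_le_one_left ht0.le (abs_le.2 hθ)
  have sq : ∀ z ∈ lowerDom, |z.1 - 1/2| ≤ 1/2 := by
    intro z hz
    have := hz.1.1
    rw [abs_le]
    constructor <;> linarith [this.1, this.2]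
  refine ⟨(K x).2 * Θ (K x).1, g (K x).1 (K x).2 * Θ (K x).1, kx.1, ab _ kx.2, ?_, ht1,
    sq x hx, sq _ hy, ex1, ex2, ey1, ey2, px_rel hg kx.1 (H.h1nn _ kx.1) ht0 kx.2⟩
  apply ab
  rw [← h2]
  exact ky.2

theorem px_rlip {x y : ℝ × ℝ} {r η φ r' η' φ' : ℝ} (h0 : 0 ≤ r + η) (h0' : 0 ≤ r' + η')
    (hm : (r ≤ r' ∧ η ≤ η') ∨ (r' ≤ r ∧ η' ≤ η))
    (x1 : x.1 = 1/2 + (r + η) * Real.sin φ) (x2 : x.2 = (r + η) * Real.cos φ - η)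
    (y1 : y.1 = 1/2 + (r' + η') * Real.sin φ') (y2 : y.2 = (r' + η') * Real.cos φ' - η') :
    |r' - r| ≤ ‖pxc y - pxc x‖ := by
  have key : ∀ {x y : ℝ × ℝ} {r η φ r' η' φ' : ℝ}, 0 ≤ r + η → 0 ≤ r' + η' →
      r ≤ r' → η ≤ η' →
      x.1 = 1/2 + (r + η) * Real.sin φ → x.2 = (r + η) * Real.cos φ - η →
      y.1 = 1/2 + (r' + η') * Real.sin φ' → y.2 = (r' + η') * Real.cos φ' - η' →
      |r' - r| ≤ ‖pxc y - pxc x‖ := by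
    intro x y r η φ r' η' φ' h0 h0' hr hη x1 x2 y1 y2
    have nn : ∀ {z : ℝ × ℝ} {r η φ : ℝ}, 0 ≤ r + η → z.1 = 1/2 + (r + η) * Real.sin φ →
        z.2 = (r + η) * Real.cos φ - η → ‖pxc z - ⟨1/2, -η⟩‖ = r + η := by
      intro z r η φ h0 z1 z2
      rw [Complex.norm_def, Complex.normSq_apply]
      simp only [pxc, Complex.sub_re, Complex.sub_im, z1, z2]
      rw [Real.sqrt_eq_iff_mul_self_eq (add_nonneg (mul_self_nonneg _) (mul_self_nonneg _)) h0]
      have := Real.sin_sq_add_cos_sq φ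
      linear_combination ((r + η)^2) * this
    have n1 := nn h0 x1 x2
    have n2 := nn h0' y1 y2
    have n3 : ‖((⟨1/2, -η⟩ : ℂ) - ⟨1/2, -η'⟩)‖ ≤ η' - η := by
      have : ((⟨1/2, -η⟩ : ℂ) - ⟨1/2, -η'⟩) = ((η' - η : ℝ) : ℂ) * Complex.I := by
        apply Complex.ext <;> simp <;> ring
      rw [this, norm_mul, Complex.norm_I, mul_one, Complex.norm_real, Real.norm_eq_abs,
        abs_of_nonneg (by linarith)]
    have e : pxc y - ⟨1/2, -η'⟩ = (pxc y - pxc x) + (pxc x - ⟨1/2, -η⟩) +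
        ((⟨1/2, -η⟩ : ℂ) - ⟨1/2, -η'⟩) := by ring
    have t := norm_add₃_le (a := pxc y - pxc x) (b := pxc x - ⟨1/2, -η⟩)
      (c := (⟨1/2, -η⟩ : ℂ) - ⟨1/2, -η'⟩)
    rw [← e] at t
    rw [abs_of_nonneg (by linarith)]
    linarith
  rcases hm with ⟨a, b⟩ | ⟨a, b⟩
  · exact key h0 h0' a b x1 x2 y1 y2
  · rw [abs_sub_comm, norm_sub_rev]
    exact key h0' h0 a b y1 y2 x1 x2

theorem PxPt.rlip {h Θ : ℝ → ℝ} {c δ : ℝ} (H : PxH h c) {x y x' y' : ℝ × ℝ} {r φ ψ r' φ' ψ' : ℝ}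
    (P : PxPt h Θ δ x y r φ ψ) (P' : PxPt h Θ δ x' y' r' φ' ψ') :
    |r' - r| ≤ ‖pxc x' - pxc x‖ := by
  refine px_rlip (H.Rpos P.hr).le (H.Rpos P'.hr).le ?_ P.x1 P.x2 P'.x1 P'.x2
  rcases le_total r r' with hl | hl
  · exact Or.inl ⟨hl, H.Rmono P.hr P'.hr hl⟩
  · exact Or.inr ⟨hl, H.Rmono P'.hr P.hr hl⟩

theorem PxPt.rlip0 {h Θ : ℝ → ℝ} {c δ : ℝ} (H : PxH h c) {x y : ℝ × ℝ} {r φ ψ : ℝ}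
    (P : PxPt h Θ δ x y r φ ψ) : r ≤ ‖pxc x - pxc (1/2, 0)‖ := by
  have := px_rlip (x := (1/2, 0)) (y := x) (r := 0) (η := 0) (φ := 0) (r' := r) (η' := h r)
    (φ' := φ) (by norm_num) (H.Rpos P.hr).le (Or.inl ⟨P.hr.1.le, H.nn r P.hr⟩) (by simp) (by simp)
    P.x1 P.x2
  rw [sub_zero] at this
  exact (le_abs_self _).trans this

theorem px_glue {S : Set (ℝ × ℝ)} (hS : Convex ℝ S) {ρ : ℝ × ℝ → ℝ}
    (hρ : ∀ x ∈ S, ∀ y ∈ S, |ρ y - ρ x| ≤ ‖pxc y - pxc x‖) {a L : ℝ} {V : ℝ × ℝ → ℂ}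
    (hlo : ∀ x ∈ S, ∀ y ∈ S, ρ x ≤ a → ρ y ≤ a → ‖V y - V x‖ ≤ L * ‖pxc y - pxc x‖)
    (hhi : ∀ x ∈ S, ∀ y ∈ S, a ≤ ρ x → a ≤ ρ y → ‖V y - V x‖ ≤ L * ‖pxc y - pxc x‖) :
    ∀ x ∈ S, ∀ y ∈ S, ‖V y - V x‖ ≤ L * ‖pxc y - pxc x‖ := by
  have key : ∀ x ∈ S, ∀ y ∈ S, ρ x ≤ a → a ≤ ρ y → ‖V y - V x‖ ≤ L * ‖pxc y - pxc x‖ := by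
    intro x hx y hy hxa hya
    set γ : ℝ → ℝ × ℝ := fun t => x + t • (y - x) with hγ
    have hγS : ∀ t ∈ Set.Icc (0:ℝ) 1, γ t ∈ S := fun t ht => hS.add_smul_sub_mem hx hy ht
    have hc : ∀ t u : ℝ, pxc (γ t) - pxc (γ u) = ((t - u : ℝ) : ℂ) * (pxc y - pxc x) := by
      intro t u
      apply Complex.ext <;> simp [pxc, hγ] <;> ring
    have hn : ∀ t u : ℝ, ‖pxc (γ t) - pxc (γ u)‖ = |t - u| * ‖pxc y - pxc x‖ := by
      intro t u
      rw [hc, norm_mul, Complex.norm_real, Real.norm_eq_abs]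
    have g0 : γ 0 = x := by simp [hγ]
    have g1 : γ 1 = y := by simp [hγ]
    have hcont : ContinuousOn (fun t => ρ (γ t)) (Set.Icc (0:ℝ) 1) := by
      have : LipschitzOnWith (Real.toNNReal ‖pxc y - pxc x‖) (fun t => ρ (γ t))
          (Set.Icc (0:ℝ) 1) := by
        refine LipschitzOnWith.of_dist_le_mul ?_
        intro t ht u hu
        rw [Real.dist_eq, Real.dist_eq, Real.coe_toNNReal _ (norm_nonneg _)]
        have := hρ _ (hγS u hu) _ (hγS t ht)
        rw [hn] at this
        linarith
      exact this.continuousOn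
    obtain ⟨t, ht, hta⟩ := intermediate_value_Icc zero_le_one hcont
      (show a ∈ Set.Icc (ρ (γ 0)) (ρ (γ 1)) by rw [g0, g1]; exact ⟨hxa, hya⟩)
    have hz := hγS t ht
    simp only at hta
    have a1 := hlo x hx _ hz hxa hta.le
    have a2 := hhi _ hz y hy hta.ge hya
    have n1 := hn t 0
    have n2 := hn 1 t
    rw [g0] at n1
    rw [g1] at n2
    rw [sub_zero, abs_of_nonneg ht.1] at n1
    rw [abs_of_nonneg (by linarith [ht.2])] at n2
    rw [n1] at a1
    rw [n2] at a2
    have t1 := norm_sub_le_norm_sub_add_norm_sub (V y) (V (γ t)) (V x)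
    calc _ ≤ _ := t1
      _ ≤ _ := add_le_add a2 a1
      _ = _ := by ring
  intro x hx y hy
  rcases le_total (ρ x) a with h1 | h1 <;> rcases le_total (ρ y) a with h2 | h2
  · exact hlo x hx y hy h1 h2
  · exact key x hx y hy h1 h2
  · rw [norm_sub_rev, norm_sub_rev (pxc y)]
    exact key y hy x hx h2 h1
  · exact hhi x hx y hy h1 h2

theorem px_chord {φ φ' : ℝ} (h1 : |φ| ≤ Real.pi / 2) (h2 : |φ'| ≤ Real.pi / 2) :
    |φ' - φ| ≤ 2 * ‖(⟨Real.sin φ' - Real.sin φ, Real.cos φ' - Real.cos φ⟩ : ℂ)‖ := by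
  have hpi := Real.pi_pos
  have hx : |φ' - φ| ≤ Real.pi := by
    have := abs_sub φ' φ
    linarith
  have q := Real.cos_le_one_sub_mul_cos_sq hx
  have hcos := Real.cos_sub φ' φ
  have n : ‖(⟨Real.sin φ' - Real.sin φ, Real.cos φ' - Real.cos φ⟩ : ℂ)‖ ^ 2 =
      2 - 2 * Real.cos (φ' - φ) := by
    rw [← Complex.normSq_eq_norm_sq, Complex.normSq_apply, hcos]
    linear_combination Real.sin_sq_add_cos_sq φ + Real.sin_sq_add_cos_sq φ'
  refine (abs_le_of_sq_le_sq' ?_ (by positivity)).2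
  rw [mul_pow, n, sq_abs]
  have h4 : Real.pi ^ 2 ≤ 16 := by
    have := Real.pi_le_four
    nlinarith
  have h5 : 1/16 ≤ 1 / Real.pi ^ 2 := one_div_le_one_div_of_le (by positivity) h4
  have h6 : 2 / Real.pi ^ 2 = 2 * (1 / Real.pi ^ 2) := by ring
  rw [h6] at q
  have := mul_le_mul_of_nonneg_right h5 (sq_nonneg (φ' - φ))
  nlinarith [sq_nonneg (φ' - φ)]

theorem px_sin_lip (a b : ℝ) : |Real.sin a - Real.sin b| ≤ |a - b| := by
  exact Real.abs_sin_sub_sin_le a b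

theorem px_cos_lip (a b : ℝ) : |Real.cos a - Real.cos b| ≤ |a - b| := by
  exact Real.abs_cos_sub_cos_le a b

theorem px_low {h Θ : ℝ → ℝ} {c r₀ : ℝ} (H : PxH h c) (hr₀ : r₀ ∈ Set.Ioo (0:ℝ) (1/2))
    (hΘ : GoodTheta h r₀ Θ) :
    ∃ L δ₁ : ℝ, 0 ≤ L ∧ 0 < δ₁ ∧ ∀ δ, |δ| ≤ δ₁ → ∀ x y r φ ψ, PxPt h Θ δ x y r φ ψ → r ≤ r₀ →
      ‖pxc y - pxc x‖ ≤ |δ| * L * r ∧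
      ∀ x' y' r' φ' ψ', PxPt h Θ δ x' y' r' φ' ψ' → r' ≤ r₀ →
        ‖(pxc y' - pxc x') - (pxc y - pxc x)‖ ≤ |δ| * L * ‖pxc x' - pxc x‖ := by
  obtain ⟨M₁, hM₁, hd, hRr, hR, hlip, hdlip⟩ := H.low hr₀
  obtain ⟨M₂, hM₂, hac⟩ := H.arccos_lip hr₀
  have sub : Set.Ioc (0:ℝ) r₀ ⊆ Set.Ioo (0:ℝ) (1/2) := fun r hr => ⟨hr.1, hr.2.trans_lt hr₀.2⟩
  obtain ⟨b, hb⟩ : ∃ z, z = Real.pi / 2 := ⟨_, rfl⟩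
  have hb0 : 0 < b := by rw [hb]; have := Real.pi_pos; positivity
  obtain ⟨M, hM⟩ : ∃ z, z = 1 + 2 * M₁ + M₂ := ⟨_, rfl⟩
  have hM1 : 1 ≤ M := by linarith
  have hM0 : 0 ≤ M := by linarith
  obtain ⟨B, hB⟩ : ∃ z, z = 2 * M * b := ⟨_, rfl⟩
  have hB0 : 0 ≤ B := by rw [hB]; positivity
  obtain ⟨C, hC⟩ : ∃ z, z = 2 * (2 * M * b + M * M + M + 2 * M * M * b) := ⟨_, rfl⟩
  have hC0 : 0 ≤ C := by rw [hC]; positivity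
  obtain ⟨C', hC'⟩ : ∃ z, z = M * C + B * M * (1 + C) := ⟨_, rfl⟩
  have hC'0 : 0 ≤ C' := by rw [hC']; positivity
  obtain ⟨L₁, hL₁⟩ : ∃ z, z = (1 + M) * B + C' * (M + 2 * (2 + 2 * M)) := ⟨_, rfl⟩
  have hL₁0 : 0 ≤ L₁ := by rw [hL₁]; positivity
  refine ⟨2 * L₁ + 2 * (M * B), min 1 (1 / (2 * (B * M + 1))), by positivity, by positivity, ?_⟩
  intro δ hδ
  have hδ1 : |δ| ≤ 1 := hδ.trans (min_le_left _ _)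
  have hδ2 : |δ| * B * M ≤ 1/2 := by
    have h1 : |δ| ≤ 1 / (2 * (B * M + 1)) := hδ.trans (min_le_right _ _)
    rw [le_div_iff₀ (by positivity)] at h1
    nlinarith [abs_nonneg δ]
  -- abstract estimate
  have core := fun r r' s t s' t' (hr : r ∈ Set.Ioc (0:ℝ) r₀) (hr' : r' ∈ Set.Ioc (0:ℝ) r₀) =>
    px_core (I := Set.Ioc (0:ℝ) r₀) (F := pxW h)
      (q := fun r φ => 1 + deriv h r - deriv h r * Real.cos φ) (T := Θ) (b := b) (M := M)
      hb0.le hM1 (fun r _ s _ => pxW_deriv h r s)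
      (fun r hr s _ => by
        have := mul_le_mul_of_nonneg_left (Real.cos_le_one s) (H.h1nn r (sub hr))
        linarith)
      (fun r hr s _ => by
        have h1 := mul_le_mul_of_nonneg_left (Real.neg_one_le_cos s) (H.h1nn r (sub hr))
        have h2 := hd r hr
        linarith)
      (fun r hr r' hr' s s' _ _ => by
        have e : (1 + deriv h r' - deriv h r' * Real.cos s') -
            (1 + deriv h r - deriv h r * Real.cos s) =
            (deriv h r' - deriv h r) * (1 - Real.cos s') -
              deriv h r * (Real.cos s' - Real.cos s) := by ring
        rw [e]
        refine (abs_sub _ _).trans ?_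
        rw [abs_mul, abs_mul, abs_of_nonneg (H.h1nn r (sub hr))]
        have a1 : |1 - Real.cos s'| ≤ 2 := by
          rw [abs_le]
          constructor <;> linarith [Real.cos_le_one s', Real.neg_one_le_cos s']
        have a2 : |deriv h r' - deriv h r| * |1 - Real.cos s'| ≤ (M₁ * |r' - r|) * 2 :=
          mul_le_mul (hdlip r hr r' hr') a1 (abs_nonneg _) (by positivity)
        have a3 : deriv h r * |Real.cos s' - Real.cos s| ≤ M₁ * |s' - s| :=
          mul_le_mul (hd r hr) (px_cos_lip _ _) (abs_nonneg _) (by positivity)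
        have p1 := abs_nonneg (r' - r)
        have p2 := abs_nonneg (s' - s)
        nlinarith [mul_nonneg (show 0 ≤ M - 2 * M₁ by linarith) p1,
          mul_nonneg (show 0 ≤ M - M₁ by linarith) p2])
      (fun r _ => by simp [pxW])
      (fun r hr => by
        obtain ⟨t0, t1⟩ := px_theta H hΘ (sub hr)
        rw [abs_of_pos t0, hb]; exact t1)
      (fun r hr r' hr' => by
        rw [hΘ.1 r hr.1 hr.2, hΘ.1 r' hr'.1 hr'.2]
        refine (hac r hr r' hr').trans ?_
        exact mul_le_mul_of_nonneg_right (by linarith) (abs_nonneg _))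
      (by rw [← hB]; exact hδ2) (r := r) (r' := r') (s := s) (t := t) (s' := s') (t' := t') hr hr'
  intro x y r φ ψ P hrr
  have hrI : r ∈ Set.Ioc (0:ℝ) r₀ := ⟨P.hr.1, hrr⟩
  have hφ : |φ| ≤ b := P.hφ.trans (P.hΘ.trans hb.ge)
  have hψ : |ψ| ≤ b := P.hψ.trans (P.hΘ.trans hb.ge)
  have hRp := H.Rpos P.hr
  have hσ : |ψ - φ| ≤ |δ| * B :=
    by rw [hB]; exact (core r r φ ψ φ ψ hrI hrI hφ hψ hφ hψ P.rel P.rel).1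
  have re : (pxc y - pxc x).re = (r + h r) * (Real.sin ψ - Real.sin φ) := by
    simp only [pxc, Complex.sub_re]; rw [P.x1, P.y1]; ring
  have im : (pxc y - pxc x).im = (r + h r) * (Real.cos ψ - Real.cos φ) := by
    simp only [pxc, Complex.sub_im]; rw [P.x2, P.y2]; ring
  constructor
  · have a1 : |(pxc y - pxc x).re| ≤ M * r * (|δ| * B) := by
      rw [re, abs_mul, abs_of_pos hRp]
      refine mul_le_mul ?_ ((px_sin_lip _ _).trans hσ) (abs_nonneg _) (by have := P.hr.1; positivity)
      refine (hRr r hrI).trans (mul_le_mul_of_nonneg_right (by linarith) P.hr.1.le)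
    have a2 : |(pxc y - pxc x).im| ≤ M * r * (|δ| * B) := by
      rw [im, abs_mul, abs_of_pos hRp]
      refine mul_le_mul ?_ ((px_cos_lip _ _).trans hσ) (abs_nonneg _) (by have := P.hr.1; positivity)
      refine (hRr r hrI).trans (mul_le_mul_of_nonneg_right (by linarith) P.hr.1.le)
    have a3 := Complex.norm_le_abs_re_add_abs_im (pxc y - pxc x)
    have a4 : 0 ≤ |δ| * L₁ * r := by have := P.hr.1; positivity
    linarith
  intro x' y' r' φ' ψ' P' hrr'
  have hrI' : r' ∈ Set.Ioc (0:ℝ) r₀ := ⟨P'.hr.1, hrr'⟩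
  have hφ' : |φ'| ≤ b := P'.hφ.trans (P'.hΘ.trans hb.ge)
  have hψ' : |ψ'| ≤ b := P'.hψ.trans (P'.hΘ.trans hb.ge)
  have hRp' := H.Rpos P'.hr
  have hσ' : |ψ' - φ'| ≤ |δ| * B :=
    by rw [hB]; exact (core r' r' φ' ψ' φ' ψ' hrI' hrI' hφ' hψ' hφ' hψ' P'.rel P'.rel).1
  have re' : (pxc y' - pxc x').re = (r' + h r') * (Real.sin ψ' - Real.sin φ') := by
    simp only [pxc, Complex.sub_re]; rw [P'.x1, P'.y1]; ring
  have im' : (pxc y' - pxc x').im = (r' + h r') * (Real.cos ψ' - Real.cos φ') := by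
    simp only [pxc, Complex.sub_im]; rw [P'.x2, P'.y2]; ring
  have hΔ := (core r r' φ ψ φ' ψ' hrI hrI' hφ hψ hφ' hψ' P.rel P'.rel).2
  rw [← hC] at hΔ
  set e := |r' - r| + |φ' - φ| with he
  have lipM : ∀ u v : ℝ, 0 ≤ v → u ≤ v → u ≤ M * v := fun u v hv huv => by nlinarith
  have hS := px_X (I := Set.Ioc (0:ℝ) r₀) (X := fun _ => Real.sin) (p := fun _ => Real.cos)
    (b := b) (M := M) (B := B) (C := C) hM1 hB0 hC0 (fun _ _ s _ => Real.hasDerivAt_sin s)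
    (fun _ _ s _ => (Real.abs_cos_le_one s).trans hM1)
    (fun r _ r' _ s s' _ _ => lipM _ _ (by positivity)
      ((px_cos_lip s' s).trans (by linarith [abs_nonneg (r' - r)])))
    hδ1 hrI hrI' hφ hψ hφ' hψ' hσ hΔ
  have hCo := px_X (I := Set.Ioc (0:ℝ) r₀) (X := fun _ => Real.cos)
    (p := fun _ s => -Real.sin s)
    (b := b) (M := M) (B := B) (C := C) hM1 hB0 hC0 (fun _ _ s _ => Real.hasDerivAt_cos s)
    (fun _ _ s _ => by rw [abs_neg]; exact (Real.abs_sin_le_one s).trans hM1)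
    (fun r _ r' _ s s' _ _ => lipM _ _ (by positivity) (by
      have := px_sin_lip s s'
      rw [abs_sub_comm s s'] at this
      have e : -Real.sin s' - -Real.sin s = Real.sin s - Real.sin s' := by ring
      rw [e]
      linarith [abs_nonneg (r' - r)]))
    hδ1 hrI hrI' hφ hψ hφ' hψ' hσ hΔ
  rw [← hC', ← he] at hS hCo
  set Δ := ‖pxc x' - pxc x‖ with hΔd
  have hrl : |r' - r| ≤ Δ := PxPt.rlip H P P'
  have hhl : |h r' - h r| ≤ M * |r' - r| :=
    (hlip r hrI r' hrI').trans (mul_le_mul_of_nonneg_right (by linarith) (abs_nonneg _))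
  have hRl : |(r' + h r') - (r + h r)| ≤ (1 + M) * |r' - r| := by
    have e : (r' + h r') - (r + h r) = (r' - r) + (h r' - h r) := by ring
    rw [e]
    refine (abs_add_le _ _).trans ?_
    linarith
  -- the angular distance
  have hang : (r + h r) * |φ' - φ| ≤ 2 * ((2 + 2 * M) * Δ) := by
    have ch := px_chord (hφ.trans hb.le) (hφ'.trans hb.le)
    set w : ℂ := ⟨Real.sin φ' - Real.sin φ, Real.cos φ' - Real.cos φ⟩ with hw
    have hid : ((r + h r : ℝ) : ℂ) * w = (pxc x' - pxc x) -
        (((r' + h r') - (r + h r) : ℝ) : ℂ) * ⟨Real.sin φ', Real.cos φ'⟩ +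
        ((h r' - h r : ℝ) : ℂ) * Complex.I := by
      apply Complex.ext
      · simp only [hw, pxc, P.x1, P'.x1, Complex.add_re, Complex.sub_re, Complex.mul_re,
          Complex.ofReal_re, Complex.ofReal_im, Complex.I_re, Complex.I_im]
        ring
      · simp only [hw, pxc, P.x2, P'.x2, Complex.add_im, Complex.sub_im, Complex.mul_im,
          Complex.ofReal_re, Complex.ofReal_im, Complex.I_re, Complex.I_im]
        ring
    have n1 : ‖(⟨Real.sin φ', Real.cos φ'⟩ : ℂ)‖ = 1 := by
      rw [Complex.norm_def, Complex.normSq_apply]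
      have : Real.sin φ' * Real.sin φ' + Real.cos φ' * Real.cos φ' = 1 := by
        linarith [Real.sin_sq_add_cos_sq φ']
      simp only [this, Real.sqrt_one]
    have n2 : (r + h r) * ‖w‖ ≤ Δ + |(r' + h r') - (r + h r)| + |h r' - h r| := by
      have : (r + h r) * ‖w‖ = ‖((r + h r : ℝ) : ℂ) * w‖ := by
        rw [norm_mul, Complex.norm_real, Real.norm_eq_abs, abs_of_pos hRp]
      rw [this, hid]
      refine (norm_add_le _ _).trans (add_le_add ((norm_sub_le _ _).trans (add_le_add le_rfl ?_)) ?_)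
      · rw [norm_mul, n1, mul_one, Complex.norm_real, Real.norm_eq_abs]
      · rw [norm_mul, Complex.norm_I, mul_one, Complex.norm_real, Real.norm_eq_abs]
    have n3 : M * |r' - r| ≤ M * Δ := mul_le_mul_of_nonneg_left hrl hM0
    have n4 : (r + h r) * |φ' - φ| ≤ (r + h r) * (2 * ‖w‖) :=
      mul_le_mul_of_nonneg_left ch hRp.le
    linarith
  have hRe : (r + h r) * e ≤ (M + 2 * (2 + 2 * M)) * Δ := by
    have h1 : (r + h r) * |r' - r| ≤ M * Δ :=
      mul_le_mul ((hR r hrI).trans (by linarith)) hrl (abs_nonneg _) hM0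
    rw [he, mul_add]
    linarith
  have comb : ∀ u u' : ℝ, |u'| ≤ |δ| * B → |u' - u| ≤ |δ| * C' * e →
      |(r' + h r') * u' - (r + h r) * u| ≤ |δ| * L₁ * Δ := by
    intro u u' h1 h2
    have e1 : (r' + h r') * u' - (r + h r) * u =
        ((r' + h r') - (r + h r)) * u' + (r + h r) * (u' - u) := by ring
    rw [e1]
    refine (abs_add_le _ _).trans ?_
    rw [abs_mul, abs_mul, abs_of_pos hRp]
    have a1 : |(r' + h r') - (r + h r)| * |u'| ≤ ((1 + M) * Δ) * (|δ| * B) :=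
      mul_le_mul (hRl.trans (mul_le_mul_of_nonneg_left hrl (by linarith))) h1 (abs_nonneg _)
        (by positivity)
    have a2 : (r + h r) * |u' - u| ≤ (|δ| * C') * ((M + 2 * (2 + 2 * M)) * Δ) := by
      calc _ ≤ (r + h r) * (|δ| * C' * e) := mul_le_mul_of_nonneg_left h2 hRp.le
        _ = (|δ| * C') * ((r + h r) * e) := by ring
        _ ≤ _ := mul_le_mul_of_nonneg_left hRe (by positivity)
    rw [hL₁]
    linarith
  have f1 := comb (Real.sin ψ - Real.sin φ) (Real.sin ψ' - Real.sin φ')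
    ((px_sin_lip _ _).trans hσ') hS
  have f2 := comb (Real.cos ψ - Real.cos φ) (Real.cos ψ' - Real.cos φ')
    ((px_cos_lip _ _).trans hσ') hCo
  have f3 := Complex.norm_le_abs_re_add_abs_im ((pxc y' - pxc x') - (pxc y - pxc x))
  rw [Complex.sub_re, Complex.sub_im, re, re', im, im'] at f3
  have a4 : 0 ≤ |δ| * (M * B) * Δ := by positivity
  linarith

theorem px_angle {h : ℝ → ℝ} {r s φ : ℝ} (hR : 0 < r + h r) (hφ : |φ| ≤ Real.pi / 2)
    (hs : s = (r + h r) * Real.sin φ) :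
    pxF h r s = (r + h r) * pxW h r φ ∧ pxD h r s = (r + h r) * Real.cos φ := by
  have hφ' := abs_le.1 hφ
  constructor
  · have e : Real.arcsin (s / (r + h r)) = φ := by
      rw [hs, mul_div_cancel_left₀ _ hR.ne']
      exact Real.arcsin_sin (by linarith [hφ'.1]) hφ'.2
    rw [pxF, e, pxW, hs]; ring
  · rw [pxD, hs]
    have hc : 0 ≤ Real.cos φ := Real.cos_nonneg_of_mem_Icc ⟨by linarith [hφ'.1], hφ'.2⟩
    have e : (r + h r) ^ 2 - ((r + h r) * Real.sin φ) ^ 2 = ((r + h r) * Real.cos φ) ^ 2 := by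
      linear_combination (-(r + h r) ^ 2) * Real.sin_sq_add_cos_sq φ
    rw [e, Real.sqrt_sq (by positivity)]

theorem px_bridge {h Θ : ℝ → ℝ} {c r₀ δ : ℝ} (H : PxH h c) (hr₀ : r₀ ∈ Set.Ioo (0:ℝ) (1/2))
    (hr₀eq : 2 * r₀ * h r₀ + r₀ ^ 2 = 1/4) (hΘ : GoodTheta h r₀ Θ) {x y : ℝ × ℝ} {r φ ψ : ℝ}
    (P : PxPt h Θ δ x y r φ ψ) (hr : r₀ ≤ r) :
    x.2 = pxX h r (x.1 - 1/2) ∧ y.2 = pxX h r (y.1 - 1/2) ∧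
    pxF h r (y.1 - 1/2) =
      pxF h r (x.1 - 1/2) + δ * (pxF h r (1/2) - |pxF h r (x.1 - 1/2)|) := by
  have hRp := H.Rpos P.hr
  have hI : r ∈ Set.Ico r₀ (1/2) := ⟨hr, P.hr.2⟩
  obtain ⟨κ, -, -, hb⟩ := H.basics hr₀ hr₀eq
  have hR12 := (hb r hI 0 (by norm_num)).1
  obtain ⟨a1, a2⟩ := px_angle (s := x.1 - 1/2) hRp (P.hφ.trans P.hΘ) (by rw [P.x1]; ring)
  obtain ⟨b1, b2⟩ := px_angle (s := y.1 - 1/2) hRp (P.hψ.trans P.hΘ) (by rw [P.y1]; ring)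
  obtain ⟨t0, t1⟩ := px_theta H hΘ P.hr
  obtain ⟨c1, -⟩ := px_angle (s := 1/2) (φ := Θ r) hRp (by rw [abs_of_pos t0]; exact t1) (by
    rw [px_theta_high H hΘ hr₀ hr₀eq hI, Real.sin_arcsin]
    · field_simp
    · have : 0 ≤ 1/2 / (r + h r) := by positivity
      linarith
    · rw [div_le_one hRp]; exact hR12.le)
  refine ⟨?_, ?_, ?_⟩
  · rw [pxX, a2, P.x2]
  · rw [pxX, b2, P.y2]
  · rw [a1, b1, c1, P.rel, abs_mul, abs_of_pos hRp]; ring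

theorem px_high {h Θ : ℝ → ℝ} {c r₀ : ℝ} (H : PxH h c) (hr₀ : r₀ ∈ Set.Ioo (0:ℝ) (1/2))
    (hr₀eq : 2 * r₀ * h r₀ + r₀ ^ 2 = 1/4) (hΘ : GoodTheta h r₀ Θ) :
    ∃ L δ₁ : ℝ, 0 ≤ L ∧ 0 < δ₁ ∧ ∀ δ, |δ| ≤ δ₁ → ∀ x y r φ ψ, PxPt h Θ δ x y r φ ψ → r₀ ≤ r →
      ∀ x' y' r' φ' ψ', PxPt h Θ δ x' y' r' φ' ψ' → r₀ ≤ r' →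
        ‖(pxc y' - pxc x') - (pxc y - pxc x)‖ ≤ |δ| * L * ‖pxc x' - pxc x‖ := by
  obtain ⟨M, hM1, dF, q1, qM, qL, dX, pM, pL, -⟩ := H.high hr₀ hr₀eq
  have hM0 : 0 ≤ M := by linarith
  obtain ⟨B, hB⟩ : ∃ z, z = 2 * M * (1/2) := ⟨_, rfl⟩
  have hB0 : 0 ≤ B := by rw [hB]; positivity
  obtain ⟨C, hC⟩ : ∃ z, z = 2 * (2 * M * (1/2) + M * M + M + 2 * M * M * (1/2)) := ⟨_, rfl⟩
  have hC0 : 0 ≤ C := by rw [hC]; positivity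
  obtain ⟨C', hC'⟩ : ∃ z, z = M * C + B * M * (1 + C) := ⟨_, rfl⟩
  have hC'0 : 0 ≤ C' := by rw [hC']; positivity
  refine ⟨2 * (C + C'), min 1 (1 / (2 * (B * M + 1))), by positivity, by positivity, ?_⟩
  intro δ hδ
  have hδ1 : |δ| ≤ 1 := hδ.trans (min_le_left _ _)
  have hδ2 : |δ| * B * M ≤ 1/2 := by
    have h1 : |δ| ≤ 1 / (2 * (B * M + 1)) := hδ.trans (min_le_right _ _)
    rw [le_div_iff₀ (by positivity)] at h1
    nlinarith [abs_nonneg δ]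
  intro x y r φ ψ P hrr x' y' r' φ' ψ' P' hrr'
  have hrI : r ∈ Set.Ico r₀ (1/2) := ⟨hrr, P.hr.2⟩
  have hrI' : r' ∈ Set.Ico r₀ (1/2) := ⟨hrr', P'.hr.2⟩
  obtain ⟨X1, Y1, E1⟩ := px_bridge H hr₀ hr₀eq hΘ P hrr
  obtain ⟨X2, Y2, E2⟩ := px_bridge H hr₀ hr₀eq hΘ P' hrr'
  obtain ⟨hσ, hΔ⟩ := px_core (I := Set.Ico r₀ (1/2)) (F := pxF h) (q := pxq h)
    (T := fun _ => 1/2) (b := 1/2) (M := M) (by norm_num) hM1 dF q1 qM qL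
    (fun r _ => by simp [pxF]) (fun r _ => by norm_num [abs_of_pos])
    (fun r _ r' _ => by rw [sub_self, abs_zero]; positivity)
    (by rw [← hB]; exact hδ2) hrI hrI' P.bx P.bY P'.bx P'.bY E1 E2
  rw [← hB] at hσ
  rw [← hC] at hΔ
  have hX := px_X (I := Set.Ico r₀ (1/2)) (X := pxX h) (p := pxp h) (b := 1/2) (M := M)
    (B := B) (C := C) hM1 hB0 hC0 dX pM pL hδ1 hrI hrI' P.bx P.bY P'.bx P'.bY hσ hΔ
  rw [← hC', ← X1, ← X2, ← Y1, ← Y2] at hX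
  have hrl := PxPt.rlip H P P'
  have hsl : |(x'.1 - 1/2) - (x.1 - 1/2)| ≤ ‖pxc x' - pxc x‖ := by
    have := Complex.abs_re_le_norm (pxc x' - pxc x)
    simp only [pxc, Complex.sub_re] at this ⊢
    have e : (x'.1 - 1/2) - (x.1 - 1/2) = x'.1 - x.1 := by ring
    rw [e]; exact this
  have he : |r' - r| + |(x'.1 - 1/2) - (x.1 - 1/2)| ≤ 2 * ‖pxc x' - pxc x‖ := by linarith
  have f3 := Complex.norm_le_abs_re_add_abs_im ((pxc y' - pxc x') - (pxc y - pxc x))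
  have g1 : ((pxc y' - pxc x') - (pxc y - pxc x)).re =
      (y'.1 - 1/2 - (x'.1 - 1/2)) - (y.1 - 1/2 - (x.1 - 1/2)) := by
    simp only [pxc, Complex.sub_re]; ring
  have g2 : ((pxc y' - pxc x') - (pxc y - pxc x)).im = (y'.2 - x'.2) - (y.2 - x.2) := by
    simp only [pxc, Complex.sub_im]
  rw [g1, g2] at f3
  have m1 := hΔ.trans (mul_le_mul_of_nonneg_left he (by positivity))
  have m2 := hX.trans (mul_le_mul_of_nonneg_left he (by positivity))
  linarith

theorem px_limit {h Θ : ℝ → ℝ} {c r₀ : ℝ} (H : PxH h c) (hr₀ : r₀ ∈ Set.Ioo (0:ℝ) (1/2))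
    (hr₀eq : 2 * r₀ * h r₀ + r₀ ^ 2 = 1/4) (hΘ : GoodTheta h r₀ Θ) {ε : ℝ} (hε : 0 < ε) :
    ∀ᶠ r in nhdsWithin (1/2 : ℝ) (Set.Iio (1/2 : ℝ)), ∀ δ, |δ| ≤ 1 → ∀ x y φ ψ,
      PxPt h Θ δ x y r φ ψ →
      |(y.1 - x.1) - δ * (1/2 - |x.1 - 1/2|)| ≤ 2 * ε ∧ |y.2 - x.2| ≤ ε := by
  obtain ⟨M, hM1, dF, q1, qM, qL, dX, pM, pL, hlim⟩ := H.high hr₀ hr₀eq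
  filter_upwards [hlim ε hε, Ioo_mem_nhdsLT hr₀.2] with r hr hrr δ hδ x y φ ψ P
  have hrI : r ∈ Set.Ico r₀ (1/2) := ⟨hrr.1.le, hrr.2⟩
  obtain ⟨X1, Y1, E1⟩ := px_bridge H hr₀ hr₀eq hΘ P hrr.1.le
  have bx := P.bx
  have bY := P.bY
  obtain ⟨s, hs⟩ : ∃ s, s = x.1 - 1/2 := ⟨_, rfl⟩
  obtain ⟨t, ht⟩ : ∃ t, t = y.1 - 1/2 := ⟨_, rfl⟩
  rw [← hs] at E1 X1 bx ⊢
  rw [← ht] at E1 Y1 bY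
  have hts : y.1 - x.1 = t - s := by rw [hs, ht]; ring
  have key : ∀ v, |v| ≤ 1/2 → |pxF h r v - v| ≤ ε / 2 := by
    intro v hv
    obtain ⟨u, hu, hu'⟩ := px_one (dF r hrI) (show |(0:ℝ)| ≤ 1/2 by norm_num) hv
    have f0 : pxF h r 0 = 0 := by simp [pxF]
    rw [f0, sub_zero, sub_zero] at hu'
    have e : pxF h r v - v = v * (pxq h r u - 1) := by rw [hu']; ring
    have hq := q1 r hrI u hu
    rw [e, abs_mul, abs_of_nonneg (show 0 ≤ pxq h r u - 1 by linarith)]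
    have := mul_le_mul hv (hr u hu).1 (by linarith) (by norm_num)
    linarith
  constructor
  · rw [hts]
    have e : (t - s) - δ * (1/2 - |s|) = -(pxF h r t - t) + (pxF h r s - s) +
        δ * ((pxF h r (1/2) - 1/2) - (|pxF h r s| - |s|)) := by rw [E1]; ring
    have k1 := key t bY
    have k2 := key s bx
    have k3 := key (1/2) (by norm_num [abs_of_pos])
    have k4 := (abs_abs_sub_abs_le_abs_sub (pxF h r s) s).trans k2
    have k5 : |δ * ((pxF h r (1/2) - 1/2) - (|pxF h r s| - |s|))| ≤ ε := by
      rw [abs_mul]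
      have := abs_sub (pxF h r (1/2) - 1/2) (|pxF h r s| - |s|)
      have := mul_le_mul hδ (this.trans (add_le_add k3 k4)) (abs_nonneg _) zero_le_one
      linarith
    rw [e]
    refine (abs_add_le _ _).trans ?_
    have := abs_add_le (-(pxF h r t - t)) (pxF h r s - s)
    rw [abs_neg] at this
    linarith
  · obtain ⟨u, hu, hu'⟩ := px_one (dX r hrI) bx bY
    rw [X1, Y1, hu', abs_mul]
    have k : |t - s| ≤ 1 := (abs_sub _ _).trans (by linarith)
    have := mul_le_mul k (hr u hu).2 (abs_nonneg _) zero_le_one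
    linarith

/-- The displacement of a map, as a complex number. -/
def pxV (Ψ : ℝ × ℝ → ℝ × ℝ) (x : ℝ × ℝ) : ℂ := pxc (Ψ x) - pxc x

theorem px_lower {h Θ : ℝ → ℝ} {c r₀ : ℝ} (H : PxH h c) (hr₀ : r₀ ∈ Set.Ioo (0:ℝ) (1/2))
    (hr₀eq : 2 * r₀ * h r₀ + r₀ ^ 2 = 1/4) (hΘ : GoodTheta h r₀ Θ)
    {K : ℝ × ℝ → ℝ × ℝ} (hK : GoodK h Θ K) :
    ∃ L δ₁ : ℝ, 0 ≤ L ∧ 0 < δ₁ ∧ ∀ δ, |δ| ≤ δ₁ → ∀ g Ψ, IsGFamily h Θ δ g → IsPsi K δ g Ψ →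
      ∀ x ∈ Set.Icc (0:ℝ) 1 ×ˢ Set.Ico (0:ℝ) (1/2), ∀ y ∈ Set.Icc (0:ℝ) 1 ×ˢ Set.Ico (0:ℝ) (1/2),
        ‖pxV Ψ y - pxV Ψ x‖ ≤ |δ| * L * ‖pxc y - pxc x‖ := by
  obtain ⟨L₁, d₁, hL₁, hd₁, low⟩ := px_low H hr₀ hΘ
  obtain ⟨L₂, d₂, hL₂, hd₂, high⟩ := px_high H hr₀ hr₀eq hΘ
  refine ⟨L₁ + L₂, min d₁ d₂, by positivity, lt_min hd₁ hd₂, ?_⟩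
  intro δ hδ g Ψ hg hΨ
  replace low := low δ (hδ.trans (min_le_left _ _))
  replace high := high δ (hδ.trans (min_le_right _ _))
  have hδ0 := abs_nonneg δ
  have cases : ∀ x ∈ Set.Icc (0:ℝ) 1 ×ˢ Set.Ico (0:ℝ) (1/2), x ≠ (1/2, 0) →
      ∃ φ ψ, PxPt h Θ δ x (Ψ x) (K x).1 φ ψ :=
    fun x hx hne => px_pt H hΘ hK hg hΨ ⟨hx, hne⟩
  have V0 : pxV Ψ (1/2, 0) = 0 := by rw [pxV, hΨ.2.1, sub_self]
  have le1 : ∀ w : ℝ, 0 ≤ w → |δ| * L₁ * w ≤ |δ| * (L₁ + L₂) * w := fun w hw => by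
    have : 0 ≤ |δ| * L₂ * w := by positivity
    linarith
  have le2 : ∀ w : ℝ, 0 ≤ w → |δ| * L₂ * w ≤ |δ| * (L₁ + L₂) * w := fun w hw => by
    have : 0 ≤ |δ| * L₁ * w := by positivity
    linarith
  classical
  set ρ : ℝ × ℝ → ℝ := fun x => if x = (1/2, 0) then 0 else (K x).1 with hρ
  have ρ0 : ρ (1/2, 0) = 0 := by simp [hρ]
  have ρ1 : ∀ x, x ≠ (1/2, 0) → ρ x = (K x).1 := fun x hx => by simp only [hρ, if_neg hx]
  refine px_glue ((convex_Icc _ _).prod (convex_Ico _ _)) (ρ := ρ) (a := r₀) ?_ ?_ ?_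
  · intro x hx y hy
    by_cases ex : x = (1/2, 0) <;> by_cases ey : y = (1/2, 0)
    · rw [ex, ey]; simp
    · obtain ⟨_, _, P⟩ := cases y hy ey
      rw [ex, ρ0, ρ1 y ey, sub_zero, abs_of_pos P.hr.1]
      exact P.rlip0 H
    · obtain ⟨_, _, P⟩ := cases x hx ex
      rw [ey, ρ0, ρ1 x ex, zero_sub, abs_neg, abs_of_pos P.hr.1, norm_sub_rev]
      exact P.rlip0 H
    · obtain ⟨_, _, P⟩ := cases x hx ex
      obtain ⟨_, _, P'⟩ := cases y hy ey
      rw [ρ1 x ex, ρ1 y ey]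
      exact PxPt.rlip H P P'
  · intro x hx y hy hxr hyr
    have single : ∀ z ∈ Set.Icc (0:ℝ) 1 ×ˢ Set.Ico (0:ℝ) (1/2), z ≠ (1/2, 0) → ρ z ≤ r₀ →
        ‖pxV Ψ z‖ ≤ |δ| * (L₁ + L₂) * ‖pxc z - pxc (1/2, 0)‖ := by
      intro z hz ez hzr
      obtain ⟨_, _, P⟩ := cases z hz ez
      rw [ρ1 z ez] at hzr
      exact ((low _ _ _ _ _ P hzr).1.trans
        (mul_le_mul_of_nonneg_left (P.rlip0 H) (by positivity))).trans (le1 _ (norm_nonneg _))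
    by_cases ex : x = (1/2, 0) <;> by_cases ey : y = (1/2, 0)
    · rw [ex, ey]; simp
    · rw [ex, V0, sub_zero]
      exact single y hy ey hyr
    · rw [ey, V0, zero_sub, norm_neg, norm_sub_rev]
      exact single x hx ex hxr
    · obtain ⟨_, _, P⟩ := cases x hx ex
      obtain ⟨_, _, P'⟩ := cases y hy ey
      rw [ρ1 x ex] at hxr
      rw [ρ1 y ey] at hyr
      exact ((low _ _ _ _ _ P hxr).2 _ _ _ _ _ P' hyr).trans (le1 _ (norm_nonneg _))
  · intro x hx y hy hxr hyr
    have ne : ∀ z : ℝ × ℝ, r₀ ≤ ρ z → z ≠ (1/2, 0) := by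
      intro z hz ez
      rw [ez, ρ0] at hz
      linarith [hr₀.1]
    have ex := ne x hxr
    have ey := ne y hyr
    obtain ⟨_, _, P⟩ := cases x hx ex
    obtain ⟨_, _, P'⟩ := cases y hy ey
    rw [ρ1 x ex] at hxr
    rw [ρ1 y ey] at hyr
    exact (high _ _ _ _ _ P hxr _ _ _ _ _ P' hyr).trans (le2 _ (norm_nonneg _))

theorem px_mid {K : ℝ × ℝ → ℝ × ℝ} {δ : ℝ} {g : ℝ → ℝ → ℝ} {Ψ : ℝ × ℝ → ℝ × ℝ}
    (hΨ : IsPsi K δ g Ψ) {z : ℝ} (hz : z ∈ Set.Icc (0:ℝ) 1) :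
    pxV Ψ (z, 1/2) = ⟨δ * (1/2 - |z - 1/2|), 0⟩ := by
  rw [pxV]
  rcases le_total z (1/2) with h1 | h1
  · rw [hΨ.2.2.2.1 z hz.1 h1, abs_of_nonpos (by linarith)]
    apply Complex.ext
    · simp only [pxc, Complex.sub_re]; ring
    · simp only [pxc, Complex.sub_im]; ring
  · rw [hΨ.2.2.2.2 z h1 hz.2, abs_of_nonneg (by linarith)]
    apply Complex.ext
    · simp only [pxc, Complex.sub_re]; ring
    · simp only [pxc, Complex.sub_im]; ring

theorem px_approx {h Θ : ℝ → ℝ} {c r₀ δ : ℝ} (H : PxH h c) (hr₀ : r₀ ∈ Set.Ioo (0:ℝ) (1/2))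
    (hr₀eq : 2 * r₀ * h r₀ + r₀ ^ 2 = 1/4) (hΘ : GoodTheta h r₀ Θ)
    {K : ℝ × ℝ → ℝ × ℝ} (hK : GoodK h Θ K) {g : ℝ → ℝ → ℝ} {Ψ : ℝ × ℝ → ℝ × ℝ}
    (hδ : |δ| ≤ 1) (hg : IsGFamily h Θ δ g) (hΨ : IsPsi K δ g Ψ) {ε : ℝ} (hε : 0 < ε)
    {z : ℝ × ℝ} (hz : z ∈ Set.Icc (0:ℝ) 1 ×ˢ Set.Icc (0:ℝ) (1/2)) :
    ∃ z' ∈ Set.Icc (0:ℝ) 1 ×ˢ Set.Ico (0:ℝ) (1/2), ‖pxc z' - pxc z‖ ≤ 3 * ε ∧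
      ‖pxV Ψ z' - pxV Ψ z‖ ≤ 3 * ε := by
  obtain ⟨z₁, z₂⟩ := z
  obtain ⟨hz1, hz2⟩ := hz
  simp only at hz1 hz2
  rcases hz2.2.lt_or_eq with hlt | heq
  · refine ⟨(z₁, z₂), ⟨hz1, hz2.1, hlt⟩, ?_, ?_⟩ <;> simp <;> linarith
  subst heq
  obtain ⟨a, ha, hsub⟩ := mem_nhdsLT_iff_exists_Ioo_subset.1 (px_limit H hr₀ hr₀eq hΘ hε)
  obtain ⟨m, hm⟩ : ∃ m, m = max a (max (1/2 - ε) (1/4)) := ⟨_, rfl⟩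
  have hm1 : a ≤ m := by rw [hm]; exact le_max_left _ _
  have hm2 : 1/2 - ε ≤ m := by rw [hm]; exact (le_max_left _ _).trans (le_max_right _ _)
  have hm3 : 1/4 ≤ m := by rw [hm]; exact (le_max_right _ _).trans (le_max_right _ _)
  have hm4 : m < 1/2 := by
    rw [hm]; exact max_lt ha (max_lt (by linarith) (by norm_num))
  obtain ⟨t, ht⟩ : ∃ t, t = (m + 1/2) / 2 := ⟨_, rfl⟩
  have hS : ((z₁, t) : ℝ × ℝ) ∈ Set.Icc (0:ℝ) 1 ×ˢ Set.Ico (0:ℝ) (1/2) :=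
    ⟨hz1, by simp only; linarith, by simp only; linarith⟩
  refine ⟨(z₁, t), hS, ?_, ?_⟩
  · refine (Complex.norm_le_abs_re_add_abs_im _).trans ?_
    simp only [pxc, Complex.sub_re, Complex.sub_im, sub_self, abs_zero, zero_add]
    rw [abs_le]
    constructor <;> linarith
  · have hne : ((z₁, t) : ℝ × ℝ) ≠ (1/2, 0) := by
      intro e
      have : t = 0 := congrArg Prod.snd e
      linarith
    obtain ⟨φ, ψ, P⟩ := px_pt H hΘ hK hg hΨ (x := (z₁, t)) ⟨hS, hne⟩
    obtain ⟨r, hr⟩ : ∃ r, r = (K (z₁, t)).1 := ⟨_, rfl⟩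
    rw [← hr] at P
    have hrt : t ≤ r := by
      have e := P.x2
      simp only at e
      have := mul_le_mul_of_nonneg_left (Real.cos_le_one φ) (H.Rpos P.hr).le
      linarith
    obtain ⟨b1, b2⟩ := hsub ⟨by linarith, P.hr.2⟩ δ hδ _ _ _ _ P
    rw [px_mid hΨ hz1]
    refine (Complex.norm_le_abs_re_add_abs_im _).trans ?_
    simp only [pxV, pxc, Complex.sub_re, Complex.sub_im, sub_zero] at b1 b2 ⊢
    linarith

theorem px_square {h Θ : ℝ → ℝ} {c r₀ : ℝ} (H : PxH h c) (hr₀ : r₀ ∈ Set.Ioo (0:ℝ) (1/2))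
    (hr₀eq : 2 * r₀ * h r₀ + r₀ ^ 2 = 1/4) (hΘ : GoodTheta h r₀ Θ)
    {K : ℝ × ℝ → ℝ × ℝ} (hK : GoodK h Θ K) :
    ∃ L δ₁ : ℝ, 0 ≤ L ∧ 0 < δ₁ ∧ ∀ δ, |δ| ≤ δ₁ → ∀ g Ψ, IsGFamily h Θ δ g → IsPsi K δ g Ψ →
      ∀ x ∈ unitSq, ∀ y ∈ unitSq, ‖pxV Ψ y - pxV Ψ x‖ ≤ |δ| * L * ‖pxc y - pxc x‖ := by
  obtain ⟨L, d, hL, hd, low⟩ := px_lower H hr₀ hr₀eq hΘ hK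
  refine ⟨L, min d 1, hL, by positivity, ?_⟩
  intro δ hδ g Ψ hg hΨ
  replace low := low δ (hδ.trans (min_le_left _ _)) g Ψ hg hΨ
  have hδ1 : |δ| ≤ 1 := hδ.trans (min_le_right _ _)
  obtain ⟨N, hN⟩ : ∃ N, N = |δ| * L := ⟨_, rfl⟩
  rw [← hN] at low ⊢
  have hN0 : 0 ≤ N := by rw [hN]; positivity
  -- closed lower half
  have half : ∀ x ∈ Set.Icc (0:ℝ) 1 ×ˢ Set.Icc (0:ℝ) (1/2),
      ∀ y ∈ Set.Icc (0:ℝ) 1 ×ˢ Set.Icc (0:ℝ) (1/2),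
      ‖pxV Ψ y - pxV Ψ x‖ ≤ N * ‖pxc y - pxc x‖ := by
    intro x hx y hy
    refine le_of_forall_pos_le_add ?_
    intro η hη
    obtain ⟨ε, hε⟩ : ∃ ε, ε = η / (6 * (N + 1)) := ⟨_, rfl⟩
    have hε0 : 0 < ε := by rw [hε]; positivity
    have hε1 : 6 * (N + 1) * ε = η := by rw [hε]; field_simp
    obtain ⟨x', hx', a1, a2⟩ := px_approx H hr₀ hr₀eq hΘ hK hδ1 hg hΨ hε0 hx
    obtain ⟨y', hy', b1, b2⟩ := px_approx H hr₀ hr₀eq hΘ hK hδ1 hg hΨ hε0 hy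
    have l := low x' hx' y' hy'
    have t1 : ‖pxV Ψ y - pxV Ψ x‖ ≤ ‖pxV Ψ y' - pxV Ψ x'‖ + 6 * ε := by
      have e : pxV Ψ y - pxV Ψ x = (pxV Ψ y' - pxV Ψ x') + (pxV Ψ x' - pxV Ψ x) -
          (pxV Ψ y' - pxV Ψ y) := by ring
      rw [e]
      have u1 := norm_sub_le ((pxV Ψ y' - pxV Ψ x') + (pxV Ψ x' - pxV Ψ x)) (pxV Ψ y' - pxV Ψ y)
      have u2 := norm_add_le (pxV Ψ y' - pxV Ψ x') (pxV Ψ x' - pxV Ψ x)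
      linarith
    have t2 : ‖pxc y' - pxc x'‖ ≤ ‖pxc y - pxc x‖ + 6 * ε := by
      have e : pxc y' - pxc x' = (pxc y - pxc x) + (pxc y' - pxc y) - (pxc x' - pxc x) := by ring
      rw [e]
      have u1 := norm_sub_le ((pxc y - pxc x) + (pxc y' - pxc y)) (pxc x' - pxc x)
      have u2 := norm_add_le (pxc y - pxc x) (pxc y' - pxc y)
      linarith
    have t3 := mul_le_mul_of_nonneg_left t2 hN0
    linarith
  -- reflection
  have refl : ∀ x ∈ unitSq, 1/2 ≤ x.2 →
      pxV Ψ x = (starRingEnd ℂ) (pxV Ψ (x.1, 1 - x.2)) := by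
    rintro ⟨x₁, x₂⟩ hx h2
    simp only at h2 ⊢
    rcases h2.lt_or_eq with hlt | heq
    · rw [pxV, pxV, hΨ.2.2.1 _ hx hlt]
      apply Complex.ext
      · simp only [pxc, Complex.sub_re, Complex.conj_re]
      · simp only [pxc, Complex.sub_im, Complex.conj_im]; ring
    · subst heq
      have e : (1:ℝ) - 1/2 = 1/2 := by norm_num
      rw [e, px_mid hΨ hx.1]
      apply Complex.ext
      · simp only [Complex.conj_re]
      · simp only [Complex.conj_im, neg_zero]
  refine px_glue ((convex_Icc _ _).prod (convex_Icc _ _)) (ρ := fun x => x.2) (a := 1/2) ?_ ?_ ?_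
  · intro x _ y _
    exact Complex.abs_im_le_norm (pxc y - pxc x)
  · intro x hx y hy h1 h2
    exact half x ⟨hx.1, hx.2.1, h1⟩ y ⟨hy.1, hy.2.1, h2⟩
  · intro x hx y hy h1 h2
    rw [refl x hx h1, refl y hy h2, ← map_sub, Complex.norm_conj]
    have m : ∀ z ∈ unitSq, (1/2:ℝ) ≤ z.2 →
        ((z.1, 1 - z.2) : ℝ × ℝ) ∈ Set.Icc (0:ℝ) 1 ×ˢ Set.Icc (0:ℝ) (1/2) := by
      intro z hz h1
      exact ⟨hz.1, by simp only; linarith [hz.2.2], by simp only; linarith⟩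
    refine (half _ (m x hx h1) _ (m y hy h2)).trans (le_of_eq ?_)
    have e : pxc (y.1, 1 - y.2) - pxc (x.1, 1 - x.2) = (starRingEnd ℂ) (pxc y - pxc x) := by
      apply Complex.ext
      · simp only [pxc, Complex.sub_re, Complex.conj_re]
      · simp only [pxc, Complex.sub_im, Complex.conj_im]; ring
    rw [e, Complex.norm_conj]

theorem px_euc (x y : ℝ × ℝ) : eucDist x y = ‖pxc y - pxc x‖ := by
  rw [eucDist, Complex.norm_def, Complex.normSq_apply]
  congr 1
  simp only [pxc, Complex.sub_re, Complex.sub_im]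
  ring

theorem stmt_5 (h : ℝ → ℝ) (hh : GoodH h)
    (r₀ : ℝ) (hr₀ : r₀ ∈ Set.Ioo (0:ℝ) (1/2)) (hr₀eq : 2 * r₀ * h r₀ + r₀ ^ 2 = 1/4)
    (Θ : ℝ → ℝ) (hΘ : GoodTheta h r₀ Θ)
    (K : ℝ × ℝ → ℝ × ℝ) (hK : GoodK h Θ K)
    (χ : ℝ) (hχ : χ ∈ Set.Ioo (0:ℝ) 1) :
    ∃ δ₀ : ℝ, 0 < δ₀ ∧
      ∀ δ : ℝ, |δ| < δ₀ → ∀ g : ℝ → ℝ → ℝ, ∀ Ψ : ℝ × ℝ → ℝ × ℝ,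
        IsGFamily h Θ δ g → IsPsi K δ g Ψ →
          ∀ x ∈ unitSq, ∀ y ∈ unitSq,
            (1 + χ)⁻¹ * eucDist x y ≤ eucDist (Ψ x) (Ψ y) ∧
            eucDist (Ψ x) (Ψ y) ≤ (1 + χ) * eucDist x y := by
  obtain ⟨c, H⟩ := px_hfacts hh
  obtain ⟨L, d, hL, hd, main⟩ := px_square H hr₀ hr₀eq hΘ hK
  obtain ⟨hχ0, hχ1⟩ := hχ
  refine ⟨min d (χ / 2 / (L + 1)), by positivity, ?_⟩
  intro δ hδ g Ψ hg hΨ x hx y hy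
  have hδ1 : |δ| ≤ d := hδ.le.trans (min_le_left _ _)
  have hδ2 : |δ| * L ≤ χ / 2 := by
    have h1 : |δ| ≤ χ / 2 / (L + 1) := hδ.le.trans (min_le_right _ _)
    rw [le_div_iff₀ (by positivity)] at h1
    linarith [abs_nonneg δ]
  have m := main δ hδ1 g Ψ hg hΨ x hx y hy
  rw [px_euc, px_euc]
  have m' := m.trans (mul_le_mul_of_nonneg_right hδ2 (norm_nonneg _))
  have e : pxc (Ψ y) - pxc (Ψ x) = (pxc y - pxc x) + (pxV Ψ y - pxV Ψ x) := by
    simp only [pxV]; ring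
  have u := norm_add_le (pxc y - pxc x) (pxV Ψ y - pxV Ψ x)
  have l := norm_sub_le ((pxc y - pxc x) + (pxV Ψ y - pxV Ψ x)) (pxV Ψ y - pxV Ψ x)
  rw [add_sub_cancel_right] at l
  rw [← e] at u l
  have n0 := norm_nonneg (pxc y - pxc x)
  have pχ : 0 ≤ χ * ‖pxc y - pxc x‖ := by positivity
  constructor
  · have i : (1 + χ)⁻¹ ≤ 1 - χ / 2 := by
      rw [inv_le_iff_one_le_mul₀ (by linarith)]
      nlinarith
    have := mul_le_mul_of_nonneg_right i n0
    linarith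
  · linarith
end
end

section
/- There exists a constant C > 0, depending only on h, such that for every δ ∈ (−1,1) and every x ∈ [0,1]², |Ψ_δ(x) − x| ≤ C·|δ|·d̃(x), where d̃(x) denotes the distance from x to the set of four corner points {(0,0),(1,0),(0,1),(1,1)} of [0,1]². -/
open MeasureTheory Set Filter

noncomputable section

/-- Distance from `x` to the set of four corners of the unit square. -/
def cornerDist (x : ℝ × ℝ) : ℝ :=
  min (min (eucDist x (0, 0)) (eucDist x (1, 0)))
      (min (eucDist x (0, 1)) (eucDist x (1, 1)))


lemma aux_min_le (x : ℝ × ℝ) (hx : x ∈ unitSq) :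
    min x.1 (1 - x.1) + min x.2 (1 - x.2) ≤ 2 * cornerDist x := by
  obtain ⟨⟨h1, h2⟩, h3, h4⟩ := hx
  have key : ∀ a b : ℝ, 0 ≤ a → 0 ≤ b → a + b ≤ 2 * Real.sqrt (a ^ 2 + b ^ 2) := by
    intro a b ha hb
    have : (a + b) / 2 ≤ Real.sqrt (a ^ 2 + b ^ 2) := by
      apply Real.le_sqrt_of_sq_le
      nlinarith [sq_nonneg (a - b)]
    linarith
  have k1 := key x.1 x.2 h1 h3
  have k2 := key (1 - x.1) x.2 (by linarith) h3
  have k3 := key x.1 (1 - x.2) h1 (by linarith)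
  have k4 := key (1 - x.1) (1 - x.2) (by linarith) (by linarith)
  have m1 := min_le_left x.1 (1 - x.1)
  have m2 := min_le_right x.1 (1 - x.1)
  have m3 := min_le_left x.2 (1 - x.2)
  have m4 := min_le_right x.2 (1 - x.2)
  have : (min x.1 (1 - x.1) + min x.2 (1 - x.2)) / 2 ≤ cornerDist x := by
    unfold cornerDist eucDist
    refine le_min (le_min ?_ ?_) (le_min ?_ ?_)
    · simp only [sub_zero]; linarith
    · simp only [sub_zero]; rw [← neg_sub 1 x.1, neg_sq]; linarith
    · simp only [sub_zero]; rw [← neg_sub 1 x.2, neg_sq]; linarith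
    · simp only []; rw [← neg_sub 1 x.2, neg_sq, ← neg_sub 1 x.1, neg_sq]; linarith
  linarith

lemma aux_cd_symm (x : ℝ × ℝ) : cornerDist (x.1, 1 - x.2) = cornerDist x := by
  unfold cornerDist eucDist
  simp only [sub_zero]
  rw [min_comm]
  congr 2 <;> congr 2 <;> ring

lemma aux_dist (R a b : ℝ) :
    (R * Real.sin a - R * Real.sin b) ^ 2 + (R * Real.cos a - R * Real.cos b) ^ 2
      ≤ (R * |a - b|) ^ 2 := by
  have h1 := Real.one_sub_sq_div_two_le_cos (x := a - b)
  rw [Real.cos_sub] at h1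
  have e : (R * Real.sin a - R * Real.sin b) ^ 2 + (R * Real.cos a - R * Real.cos b) ^ 2
      = R ^ 2 * (2 - 2 * (Real.cos a * Real.cos b + Real.sin a * Real.sin b)) := by
    linear_combination R ^ 2 * Real.sin_sq_add_cos_sq a + R ^ 2 * Real.sin_sq_add_cos_sq b
  rw [e, mul_pow, sq_abs]
  apply mul_le_mul_of_nonneg_left _ (sq_nonneg R)
  linarith

lemma aux_arc (φ T : ℝ) (h0 : 0 ≤ φ) (h1 : φ ≤ T) (h2 : T ≤ Real.pi / 2) :
    T - φ ≤ 2 * ((Real.sin T - Real.sin φ) + (Real.cos φ - Real.cos T)) := by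
  have hpi := Real.pi_pos
  have hpi4 := Real.pi_le_four
  have ha : 0 ≤ Real.sin T - Real.sin φ :=
    sub_nonneg.2 (Real.sin_le_sin_of_le_of_le_pi_div_two (by linarith) h2 h1)
  have hb : 0 ≤ Real.cos φ - Real.cos T :=
    sub_nonneg.2 (Real.cos_le_cos_of_nonneg_of_le_pi h0 (by linarith) h1)
  have hq := Real.cos_le_one_sub_mul_cos_sq (x := T - φ)
    (by rw [abs_of_nonneg (by linarith)]; linarith)
  rw [Real.cos_sub] at hq
  have hc : (1:ℝ) / 8 ≤ 2 / Real.pi ^ 2 := by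
    rw [div_le_div_iff₀ (by norm_num) (by positivity)]
    nlinarith
  have hq2 : Real.cos T * Real.cos φ + Real.sin T * Real.sin φ ≤ 1 - 1 / 8 * (T - φ) ^ 2 := by
    nlinarith [mul_le_mul_of_nonneg_right hc (sq_nonneg (T - φ))]
  apply le_of_sq_le_sq _ (by linarith)
  have e : (Real.sin T - Real.sin φ) ^ 2 + (Real.cos φ - Real.cos T) ^ 2
      = 2 - 2 * (Real.cos T * Real.cos φ + Real.sin T * Real.sin φ) := by
    linear_combination Real.sin_sq_add_cos_sq T + Real.sin_sq_add_cos_sq φ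
  nlinarith [mul_nonneg ha hb]

lemma aux_int_lower (w : ℝ → ℝ) (hw : Continuous w) (h1 : ∀ t, 1 ≤ w t) (a b : ℝ) :
    |b - a| ≤ |∫ t in a..b, w t| := by
  have main : ∀ a b : ℝ, a ≤ b → |b - a| ≤ |∫ t in a..b, w t| := by
    intro a b hab
    have : ∫ t in a..b, (1:ℝ) ≤ ∫ t in a..b, w t :=
      intervalIntegral.integral_mono_on hab (by simp) (hw.intervalIntegrable _ _)
        (fun t _ => h1 t)
    simp at this
    rw [abs_of_nonneg (by linarith)]
    exact le_trans (by linarith) (le_abs_self _)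
  rcases le_total a b with hab | hab
  · exact main a b hab
  · rw [intervalIntegral.integral_symm, abs_neg, abs_sub_comm]; exact main b a hab

lemma aux_int_upper (w : ℝ → ℝ) (hw : Continuous w) (B : ℝ) (a b : ℝ) (hab : a ≤ b)
    (h0 : ∀ t ∈ Set.Icc a b, 0 ≤ w t) (h1 : ∀ t ∈ Set.Icc a b, w t ≤ B) :
    |∫ t in a..b, w t| ≤ B * (b - a) := by
  rw [abs_of_nonneg (intervalIntegral.integral_nonneg hab h0)]
  have : ∫ t in a..b, w t ≤ ∫ t in a..b, B :=
    intervalIntegral.integral_mono_on hab (hw.intervalIntegrable _ _) (by simp) h1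
  simp at this
  linarith

lemma aux_g (w : ℝ → ℝ) (hw : Continuous w) (B δ : ℝ) (h1 : ∀ t, 1 ≤ w t)
    (hB : ∀ t ∈ Set.Icc (-1:ℝ) 1, w t ≤ B) (l y : ℝ) (hl : l ∈ Set.Icc (-1:ℝ) 1)
    (hL : l ∈ Set.Icc (-1:ℝ) 0 → (1 + δ) * ∫ θ in (-1:ℝ)..l, w θ = ∫ θ in (-1:ℝ)..y, w θ)
    (hR : l ∈ Set.Icc (0:ℝ) 1 → (1 - δ) * ∫ θ in l..(1:ℝ), w θ = ∫ θ in y..(1:ℝ), w θ) :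
    |y - l| ≤ |δ| * (B * (1 - |l|)) := by
  refine (aux_int_lower w hw h1 l y).trans ?_
  have ii : ∀ a b : ℝ, IntervalIntegrable w volume a b := fun a b => hw.intervalIntegrable a b
  rcases le_total l 0 with h | h
  · have e := hL ⟨hl.1, h⟩
    have a := intervalIntegral.integral_add_adjacent_intervals (ii (-1) l) (ii l y)
    have : ∫ t in l..y, w t = δ * ∫ t in (-1:ℝ)..l, w t := by linarith
    rw [this, abs_mul, abs_of_nonpos h]
    apply mul_le_mul_of_nonneg_left _ (abs_nonneg _)
    have := aux_int_upper w hw B (-1) l hl.1 (fun t _ => by linarith [h1 t])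
      (fun t ht => hB t ⟨ht.1, ht.2.trans hl.2⟩)
    linarith
  · have e := hR ⟨h, hl.2⟩
    have a := intervalIntegral.integral_add_adjacent_intervals (ii l y) (ii y 1)
    have : ∫ t in l..y, w t = δ * ∫ t in l..(1:ℝ), w t := by linarith
    rw [this, abs_mul, abs_of_nonneg h]
    apply mul_le_mul_of_nonneg_left _ (abs_nonneg _)
    exact aux_int_upper w hw B l 1 hl.2 (fun t _ => by linarith [h1 t])
      (fun t ht => hB t ⟨hl.1.trans ht.1, ht.2⟩)

lemma aux_theta (h : ℝ → ℝ) (hh : GoodH h) (r₀ : ℝ) (Θ : ℝ → ℝ) (hΘ : GoodTheta h r₀ Θ)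
    (r : ℝ) (hr : r ∈ Set.Ioo (0:ℝ) (1/2)) : 0 ≤ Θ r ∧ Θ r ≤ Real.pi / 2 := by
  have h0 := hh.1 r ⟨hr.1.le, hr.2⟩
  have hr1 := hr.1
  rcases le_or_gt r r₀ with hc | hc
  · rw [hΘ.1 r hr.1 hc]
    exact ⟨Real.arccos_nonneg _, Real.arccos_le_pi_div_two.2 (by positivity)⟩
  · rw [hΘ.2 r hc hr.2]
    exact ⟨Real.arcsin_nonneg.2 (by positivity), Real.arcsin_le_pi_div_two _⟩

lemma aux_deriv (h : ℝ → ℝ) (hh : GoodH h) (r : ℝ) (hr : r ∈ Set.Ioo (0:ℝ) (1/2)) :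
    0 ≤ deriv h r := by
  have := hh.2.1.derivWithin_nonneg (x := r)
  rwa [derivWithin_of_mem_nhds (Ico_mem_nhds hr.1 hr.2)] at this

set_option maxHeartbeats 2000000 in
/-- Everything on the domain of the parametrisation. -/
lemma aux_lower (h : ℝ → ℝ) (hh : GoodH h)
    (r₀ : ℝ) (Θ : ℝ → ℝ) (hΘ : GoodTheta h r₀ Θ)
    (K : ℝ × ℝ → ℝ × ℝ) (hK : GoodK h Θ K) :
    ∃ B : ℝ, 1 ≤ B ∧
      ∀ δ ∈ Set.Ioo (-1:ℝ) 1, ∀ g : ℝ → ℝ → ℝ, ∀ Ψ : ℝ × ℝ → ℝ × ℝ,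
        IsGFamily h Θ δ g → IsPsi K δ g Ψ →
          ∀ x ∈ lowerDom, eucDist (Ψ x) x ≤
            B * |δ| * (2 * (min x.1 (1 - x.1) + min x.2 (1 - x.2))) := by
  obtain ⟨c, hc⟩ := hh.2.2.2.2.2
  have hpi := Real.pi_pos
  have hpi4 := Real.pi_le_four
  refine ⟨2 + 16 * |c|, by linarith [abs_nonneg c], ?_⟩
  intro δ hδ g Ψ hg hΨ x hx
  obtain ⟨hy, hy1, hy2⟩ := hΨ.1 x hx
  have hKx := hK.1.mapsTo hx
  obtain ⟨hx1, hx2⟩ := hK.2 x hx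
  obtain ⟨ey1, ey2⟩ := hK.2 _ hy
  rw [hy1, hy2] at ey1 ey2
  obtain ⟨hr, hl⟩ := hKx
  obtain ⟨p, hp, hKp⟩ := hK.1.surjOn (show ((K x).1, (-1:ℝ)) ∈ _ from ⟨hr, by norm_num⟩)
  obtain ⟨q, hq, hKq⟩ := hK.1.surjOn (show ((K x).1, (1:ℝ)) ∈ _ from ⟨hr, by norm_num⟩)
  obtain ⟨ep1, ep2⟩ := hK.2 _ hp
  obtain ⟨eq1, eq2⟩ := hK.2 _ hq
  rw [hKp] at ep1 ep2
  rw [hKq] at eq1 eq2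
  obtain ⟨⟨⟨hp1, -⟩, hp2, -⟩, -⟩ := hp
  obtain ⟨⟨⟨-, hq1⟩, hq2, -⟩, -⟩ := hq
  obtain ⟨⟨⟨hx1a, hx1b⟩, hx2a, hx2b⟩, -⟩ := hx
  clear hKp hKq hy1 hy2 hy
  generalize (K x).1 = r at *
  generalize (K x).2 = l at *
  simp only [neg_mul, one_mul, Real.sin_neg, Real.cos_neg, mul_neg] at ep1 ep2 eq1 eq2
  have hh0 := hh.1 r ⟨hr.1.le, hr.2⟩
  obtain ⟨hT0, hT1⟩ := aux_theta h hh r₀ Θ hΘ r hr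
  have hd0 := aux_deriv h hh r hr
  have hR0 : 0 ≤ r + h r := by linarith [hr.1]
  have hd2 := (hc r ⟨hr.1.le, hr.2⟩).1
  obtain ⟨-, hgb, -, -, hgL, hgR⟩ := hg r hr
  have hcont : Continuous (wgt h Θ r) := by
    unfold wgt; fun_prop
  generalize hTe : Θ r = T at *
  generalize hRe : r + h r = R at *
  have hRT : R * T ≤ 1 := by
    have h1 := Real.mul_le_sin hT0 hT1
    have h2 : 2 / Real.pi * T * R ≤ 1 / 2 := by
      nlinarith [mul_le_mul_of_nonneg_right h1 hR0]
    have h3 : (1:ℝ) / 2 ≤ 2 / Real.pi := by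
      rw [div_le_div_iff₀ (by norm_num) hpi]; linarith
    nlinarith [mul_le_mul_of_nonneg_right h3 (mul_nonneg hT0 hR0)]
  have hT2 : T ≤ 2 := by linarith
  have hRT0 : 0 ≤ R * T := mul_nonneg hR0 hT0
  have hpow : R ^ 3 * T ^ 4 ≤ 16 := by
    rcases le_total R 1 with h1 | h1
    · have a1 : R ^ 3 ≤ 1 := pow_le_one₀ hR0 h1
      have a2 : T ^ 4 ≤ 2 ^ 4 := pow_le_pow_left₀ hT0 hT2 4
      have a3 : 0 ≤ T ^ 4 := by positivity
      nlinarith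
    · have a1 : (R * T) ^ 4 ≤ 1 := pow_le_one₀ hRT0 hRT
      have a3 : 0 ≤ R ^ 3 * T ^ 4 := by positivity
      have a4 : (R * T) ^ 4 = R * (R ^ 3 * T ^ 4) := by ring
      nlinarith
  have hM : deriv h r * T ^ 2 ≤ 1 + 16 * |c| := by
    have a1 : (deriv h r * T ^ 2) ^ 2 ≤ 16 * |c| := by
      have b1 : 0 ≤ T ^ 4 := by positivity
      have b2 : c * R ^ 3 ≤ |c| * R ^ 3 :=
        mul_le_mul_of_nonneg_right (le_abs_self c) (by positivity)
      calc (deriv h r * T ^ 2) ^ 2 = deriv h r ^ 2 * T ^ 4 := by ring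
        _ ≤ (|c| * R ^ 3) * T ^ 4 := mul_le_mul_of_nonneg_right (hd2.trans b2) b1
        _ = |c| * (R ^ 3 * T ^ 4) := by ring
        _ ≤ |c| * 16 := mul_le_mul_of_nonneg_left hpow (abs_nonneg c)
        _ = 16 * |c| := by ring
    nlinarith [sq_nonneg (deriv h r * T ^ 2 - 1)]
  have hw1 : ∀ t, 1 ≤ wgt h Θ r t := by
    intro t
    unfold wgt
    nlinarith [mul_nonneg hd0 (sub_nonneg.2 (Real.cos_le_one (t * Θ r)))]
  have hwB : ∀ t ∈ Set.Icc (-1:ℝ) 1, wgt h Θ r t ≤ 2 + 16 * |c| := by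
    intro t ht
    unfold wgt
    rw [hTe]
    have a1 := Real.one_sub_sq_div_two_le_cos (x := t * T)
    have a2 : (t * T) ^ 2 ≤ T ^ 2 := by
      rw [mul_pow]
      have : t ^ 2 ≤ 1 := by nlinarith [ht.1, ht.2]
      nlinarith [sq_nonneg T]
    have a3 : 1 - Real.cos (t * T) ≤ T ^ 2 := by linarith [sq_nonneg T]
    have a4 := mul_le_mul_of_nonneg_left a3 hd0
    rw [mul_sub, mul_one] at a4
    linarith
  have hgl := aux_g (wgt h Θ r) hcont _ δ hw1 hwB l (g r l) hl (hgL l) (hgR l)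
  have hB0 : 0 ≤ (2 + 16 * |c|) * |δ| := by positivity
  -- the chord is at most the arc
  have hdist : eucDist (Ψ x) x ≤ R * T * |g r l - l| := by
    unfold eucDist
    rw [ey1, ey2, hx1, hx2]
    apply Real.sqrt_le_iff.2
    refine ⟨by positivity, ?_⟩
    have := aux_dist R (g r l * T) (l * T)
    rw [← sub_mul, abs_mul, abs_of_nonneg hT0] at this
    calc _ = _ := by ring
      _ ≤ _ := this
      _ = _ := by ring
  -- the arc to the boundary is controlled by the coordinates
  have harc : R * T * (1 - |l|) ≤ 2 * (min x.1 (1 - x.1) + min x.2 (1 - x.2)) := by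
    have hl1 : |l| ≤ 1 := abs_le.2 hl
    have hφ0 : 0 ≤ |l| * T := by positivity
    have hφ1 : |l| * T ≤ T := by nlinarith
    have ha := mul_le_mul_of_nonneg_left (aux_arc (|l| * T) T hφ0 hφ1 hT1) hR0
    have hs : 0 ≤ R * Real.sin (|l| * T) :=
      mul_nonneg hR0 (Real.sin_nonneg_of_nonneg_of_le_pi hφ0 (by linarith))
    have hm2 : min x.2 (1 - x.2) = x.2 := min_eq_left (by linarith)
    rw [hm2]
    rcases le_total l 0 with h0 | h0
    · rw [abs_of_nonpos h0] at *
      rw [neg_mul, Real.sin_neg, Real.cos_neg] at ha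
      rw [neg_mul, Real.sin_neg] at hs
      have hm1 : min x.1 (1 - x.1) = x.1 := min_eq_left (by linarith)
      rw [hm1]
      nlinarith
    · rw [abs_of_nonneg h0] at *
      have hm1 : min x.1 (1 - x.1) = 1 - x.1 := min_eq_right (by linarith)
      rw [hm1]
      nlinarith
  calc eucDist (Ψ x) x ≤ R * T * |g r l - l| := hdist
    _ ≤ R * T * (|δ| * ((2 + 16 * |c|) * (1 - |l|))) := mul_le_mul_of_nonneg_left hgl hRT0
    _ = (2 + 16 * |c|) * |δ| * (R * T * (1 - |l|)) := by ring
    _ ≤ _ := mul_le_mul_of_nonneg_left harc hB0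

theorem stmt_6 (h : ℝ → ℝ) (hh : GoodH h)
    (r₀ : ℝ) (hr₀ : r₀ ∈ Set.Ioo (0:ℝ) (1/2)) (hr₀eq : 2 * r₀ * h r₀ + r₀ ^ 2 = 1/4)
    (Θ : ℝ → ℝ) (hΘ : GoodTheta h r₀ Θ)
    (K : ℝ × ℝ → ℝ × ℝ) (hK : GoodK h Θ K) :
    ∃ C : ℝ, 0 < C ∧
      ∀ δ ∈ Set.Ioo (-1:ℝ) 1, ∀ g : ℝ → ℝ → ℝ, ∀ Ψ : ℝ × ℝ → ℝ × ℝ,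
        IsGFamily h Θ δ g → IsPsi K δ g Ψ →
          ∀ x ∈ unitSq, eucDist (Ψ x) x ≤ C * |δ| * cornerDist x := by
  obtain ⟨B, hB1, hB⟩ := aux_lower h hh r₀ Θ hΘ K hK
  refine ⟨4 * B, by linarith, ?_⟩
  intro δ hδ g Ψ hg hΨ
  have cd0 : ∀ x, 0 ≤ cornerDist x := by
    intro x
    unfold cornerDist eucDist
    positivity
  have low : ∀ x ∈ unitSq, x.2 < 1 / 2 → eucDist (Ψ x) x ≤ 4 * B * |δ| * cornerDist x := by
    intro x hx hx2
    by_cases hxe : x = (1 / 2, 0)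
    · have hz : eucDist (Ψ x) x = 0 := by
        rw [hxe, hΨ.2.1]; simp [eucDist]
      rw [hz]
      have := cd0 x
      positivity
    · have hd : x ∈ lowerDom := ⟨⟨hx.1, hx.2.1, hx2⟩, hxe⟩
      refine (hB δ hδ g Ψ hg hΨ x hd).trans ?_
      have h1 := aux_min_le x hx
      have h2 : 0 ≤ B * |δ| := by positivity
      nlinarith [mul_le_mul_of_nonneg_left h1 h2]
  intro x hx
  rcases lt_trichotomy x.2 (1 / 2) with h2 | h2 | h2
  · exact low x hx h2
  · have hmin := aux_min_le x hx
    have h4 : |δ| * (min x.1 (1 - x.1) + min x.2 (1 - x.2)) ≤ 4 * B * |δ| * cornerDist x := by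
      have h5 := cd0 x
      have h6 : |δ| * (2 * cornerDist x) ≤ 4 * B * |δ| * cornerDist x := by
        have : 0 ≤ |δ| * cornerDist x := by positivity
        nlinarith
      exact (mul_le_mul_of_nonneg_left hmin (abs_nonneg δ)).trans h6
    refine le_trans ?_ h4
    obtain ⟨x1, x2⟩ := x
    simp only at h2
    subst h2
    obtain ⟨⟨ha, hb⟩, -⟩ := hx
    simp only at ha hb
    have hm2 : (0:ℝ) ≤ min (1 / 2) (1 - 1 / 2) := by norm_num
    rcases le_total x1 (1 / 2) with hc | hc
    · rw [hΨ.2.2.2.1 x1 ha hc]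
      have e : eucDist ((1 + δ) * x1, 1 / 2) (x1, 1 / 2) = |δ| * x1 := by
        unfold eucDist
        simp only [sub_self]
        rw [show ((1 + δ) * x1 - x1) ^ 2 + (0:ℝ) ^ 2 = (δ * x1) ^ 2 by ring, Real.sqrt_sq_eq_abs,
          abs_mul, abs_of_nonneg ha]
      rw [e]
      apply mul_le_mul_of_nonneg_left _ (abs_nonneg δ)
      simp only
      rw [min_eq_left (by linarith : x1 ≤ 1 - x1)]
      linarith
    · rw [hΨ.2.2.2.2 x1 hc hb]
      have e : eucDist ((1 + δ) / 2 + (1 - δ) * (x1 - 1 / 2), 1 / 2) (x1, 1 / 2)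
          = |δ| * (1 - x1) := by
        unfold eucDist
        simp only [sub_self]
        rw [show ((1 + δ) / 2 + (1 - δ) * (x1 - 1 / 2) - x1) ^ 2 + (0:ℝ) ^ 2
            = (δ * (1 - x1)) ^ 2 by ring, Real.sqrt_sq_eq_abs,
          abs_mul, abs_of_nonneg (by linarith : 0 ≤ 1 - x1)]
      rw [e]
      apply mul_le_mul_of_nonneg_left _ (abs_nonneg δ)
      simp only
      rw [min_eq_right (by linarith : 1 - x1 ≤ x1)]
      linarith
  · have hx' : (x.1, 1 - x.2) ∈ unitSq :=
      ⟨hx.1, by simp only; linarith [hx.2.2], by simp only; linarith [hx.2.1]⟩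
    have := low (x.1, 1 - x.2) hx' (by simp only; linarith)
    rw [aux_cd_symm] at this
    refine le_trans (le_of_eq ?_) this
    rw [hΨ.2.2.1 x hx h2]
    unfold eucDist
    simp only
    congr 1
    ring
end
end
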